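/- arXiv:1807.02179 — 3 statements merged into one kernel-verified Lean document; each statement's English description precedes it below -/
import Mathlib

section
/- Let Q be an acyclic quiver on vertices {1,…,n}, labeled so that h(a) < t(a) for every arrow a; let Q• be an admissible Dynkin subquiver partition with allowed total order φ₁ ≺ ⋯ ≺ φ_r on Φ(Q,Q•). For every dimension vector γ ∈ ℕⁿ the following identity holds in ℚ(t): Π_{i=1}^n P_{γ(i)} = Σ_m t^{2c_m} Π_{u=1}^r P_{m_u}, where the (finite) sum is over all compatible Kostant series m = (m₁,…,m_r) ∈ ℕ^r with Σ_{u=1}^r m_u φ_u = γ, and 2c_m = Σ_{u<v} m_u m_v λ(φ_u,φ_v) − Σ_{i<i'} γ(i)γ(i') λ(e_i,e_{i'}) − Σ_{i=1}^n γ(i)² + Σ_{u=1}^r m_u² (this integer 2c_m is twice the complex codimension of the quiver stratum η_m in Rep_γ(Q), so the identity expresses the Poincaré series of H*(BG_γ) as a sum of shifted Poincaré series of the strata's isotropy groups). -/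
open scoped BigOperators

/-- A quiver on vertex set `Fin n` with `m` arrows, each arrow `a` having a
tail `ta a` and a head `ha a`. -/
structure Quiv (n : ℕ) where
  m : ℕ
  ta : Fin m → Fin n
  ha : Fin m → Fin n

namespace Quiv

variable {n : ℕ}

/-- Coerce a dimension vector in `ℕⁿ` to `ℤⁿ`. -/
def toZ {n : ℕ} (γ : Fin n → ℕ) : Fin n → ℤ := fun i => (γ i : ℤ)

/-- The Euler form of the subquiver with vertex set `V` and arrow set `A`. -/
def chiSub (Q : Quiv n) (V : Finset (Fin n)) (A : Finset (Fin Q.m))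
    (γ₁ γ₂ : Fin n → ℤ) : ℤ :=
  (∑ i ∈ V, γ₁ i * γ₂ i) - ∑ a ∈ A, γ₁ (Q.ta a) * γ₂ (Q.ha a)

/-- The Euler form `χ` of `Q`. -/
def chi (Q : Quiv n) (γ₁ γ₂ : Fin n → ℤ) : ℤ :=
  Q.chiSub Finset.univ Finset.univ γ₁ γ₂

/-- `λ(γ₁,γ₂) = χ(γ₂,γ₁) − χ(γ₁,γ₂)`, the antisymmetrized Euler form. -/
def lam (Q : Quiv n) (γ₁ γ₂ : Fin n → ℤ) : ℤ := Q.chi γ₂ γ₁ - Q.chi γ₁ γ₂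

/-- `λ_A`, the restriction of `λ` to a subset `A` of the arrows. -/
def lamA (Q : Quiv n) (A : Finset (Fin Q.m)) (γ₁ γ₂ : Fin n → ℤ) : ℤ :=
  ∑ a ∈ A, (γ₁ (Q.ta a) * γ₂ (Q.ha a) - γ₂ (Q.ta a) * γ₁ (Q.ha a))

/-- No directed cycle using only arrows from `A`. -/
def AcyclicOn (Q : Quiv n) (A : Finset (Fin Q.m)) : Prop :=
  ¬ ∃ (k : ℕ) (c : ZMod (k + 1) → Fin Q.m),
      (∀ i, c i ∈ A) ∧ ∀ i, Q.ha (c i) = Q.ta (c (i + 1))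

/-- The quiver `Q` is acyclic: it has no directed cycle. -/
def Acyclic (Q : Quiv n) : Prop := Q.AcyclicOn Finset.univ

/-- Undirected adjacency via an arrow from `A`. -/
def AdjOn (Q : Quiv n) (A : Finset (Fin Q.m)) (x y : Fin n) : Prop :=
  ∃ a ∈ A, (Q.ta a = x ∧ Q.ha a = y) ∨ (Q.ta a = y ∧ Q.ha a = x)

/-- The subquiver `(V, A)` is connected as an undirected graph. -/
def ConnectedOn (Q : Quiv n) (V : Finset (Fin n)) (A : Finset (Fin Q.m)) : Prop :=
  ∀ x ∈ V, ∀ y ∈ V, Relation.ReflTransGen (Q.AdjOn A) x y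

/-- The Tits form of the subquiver `(V,A)` is positive definite. -/
def PosDefOn (Q : Quiv n) (V : Finset (Fin n)) (A : Finset (Fin Q.m)) : Prop :=
  ∀ γ : Fin n → ℤ, (∀ i, i ∉ V → γ i = 0) → γ ≠ 0 → 0 < Q.chiSub V A γ γ

/-- The subquiver `(V,A)` is a (nonempty, connected, acyclic, positive-definite
Tits form) Dynkin quiver. -/
def DynkinOn (Q : Quiv n) (V : Finset (Fin n)) (A : Finset (Fin Q.m)) : Prop :=
  V.Nonempty ∧ (∀ a ∈ A, Q.ta a ∈ V ∧ Q.ha a ∈ V) ∧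
    Q.ConnectedOn V A ∧ Q.AcyclicOn A ∧ Q.PosDefOn V A

/-- The set of positive roots of the subquiver `(V,A)`: nonzero dimension
vectors supported on `V` with `χ(β,β) = 1`. -/
def PosRootsOn (Q : Quiv n) (V : Finset (Fin n)) (A : Finset (Fin Q.m)) :
    Set (Fin n → ℕ) :=
  {β | β ≠ 0 ∧ (∀ i, i ∉ V → β i = 0) ∧ Q.chiSub V A (toZ β) (toZ β) = 1}

/-- A Dynkin subquiver partition `Q• = {Q¹,…,Q^ℓ}` of `Q`: each block is a
subquiver `(V j, A j)`, the vertex sets partition `Q₀`, and each block is a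
nonempty connected Dynkin quiver. -/
structure DSP (Q : Quiv n) (ℓ : ℕ) where
  V : Fin ℓ → Finset (Fin n)
  A : Fin ℓ → Finset (Fin Q.m)
  cover : ∀ i : Fin n, ∃! j, i ∈ V j
  dynkin : ∀ j, Q.DynkinOn (V j) (A j)

/-- Arrows of `Q` not belonging to any block, i.e. arrows of the contracted
quiver `P(Q,Q•)`. -/
def DSP.Cut {Q : Quiv n} {ℓ : ℕ} (P : DSP Q ℓ) (a : Fin Q.m) : Prop :=
  ∀ j, a ∉ P.A j

/-- `Q•` is admissible: the contracted quiver `P(Q,Q•)` is acyclic, i.e. there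
is no cyclic sequence of cut arrows in which the block of the head of each
arrow is the block of the tail of the next one. -/
def DSP.Admissible {Q : Quiv n} {ℓ : ℕ} (P : DSP Q ℓ) : Prop :=
  ¬ ∃ (k : ℕ) (c : ZMod (k + 1) → Fin Q.m),
      (∀ i, P.Cut (c i)) ∧
      ∀ i, ∃ j : Fin ℓ, Q.ha (c i) ∈ P.V j ∧ Q.ta (c (i + 1)) ∈ P.V j

/-- `Q•` is ordered: every cut arrow goes from a higher-indexed block (tail)
to a lower-indexed block (head). -/
def DSP.Ordered {Q : Quiv n} {ℓ : ℕ} (P : DSP Q ℓ) : Prop :=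
  ∀ a : Fin Q.m, P.Cut a →
    ∀ j j' : Fin ℓ, Q.ha a ∈ P.V j → Q.ta a ∈ P.V j' → j < j'

/-- `Φ(Q,Q•) = ∪_j Φ^j`. -/
def DSP.Roots {Q : Quiv n} {ℓ : ℕ} (P : DSP Q ℓ) : Set (Fin n → ℕ) :=
  ⋃ j, Q.PosRootsOn (P.V j) (P.A j)

/-- An allowed total order `φ₁ ≺ ⋯ ≺ φ_r` on `Φ(Q,Q•)`: an enumeration such
that for `u < v`, `λ(φ_u,φ_v) ≥ 0` if `φ_u, φ_v` lie in the same `Φ^j` and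
`λ(φ_u,φ_v) ≤ 0` if they lie in different `Φ^j`'s. -/
def DSP.AllowedOrder {Q : Quiv n} {ℓ : ℕ} (P : DSP Q ℓ) {r : ℕ}
    (φ : Fin r → (Fin n → ℕ)) : Prop :=
  Function.Injective φ ∧ Set.range φ = P.Roots ∧
    ∀ u v : Fin r, u < v →
      ((∃ j, φ u ∈ Q.PosRootsOn (P.V j) (P.A j) ∧
          φ v ∈ Q.PosRootsOn (P.V j) (P.A j)) →
        0 ≤ Q.lam (toZ (φ u)) (toZ (φ v))) ∧
      ((¬ ∃ j, φ u ∈ Q.PosRootsOn (P.V j) (P.A j) ∧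
          φ v ∈ Q.PosRootsOn (P.V j) (P.A j)) →
        Q.lam (toZ (φ u)) (toZ (φ v)) ≤ 0)

end Quiv

noncomputable section

open Quiv

/-- The underlying vector space of the completed quantum algebra `Â_Q`:
functions from dimension vectors to `ℚ(t)`. -/
abbrev AQ (n : ℕ) := (Fin n → ℕ) → RatFunc ℚ

/-- The variable `t = q^{1/2}` of `ℚ(t)`. -/
def tq : RatFunc ℚ := RatFunc.X

/-- The unit of `Â_Q`: the indicator function of the zero dimension vector. -/
def oneQ {n : ℕ} : AQ n := fun γ => if γ = 0 then 1 else 0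

/-- The generator `y_γ = −δ_γ` of the quantum algebra. -/
def yQ {n : ℕ} (γ : Fin n → ℕ) : AQ n := fun δ => if δ = γ then -1 else 0

/-- The twisted convolution product of the quantum algebra:
`(f·g)(γ) = Σ_{γ₁+γ₂=γ} t^{λ(γ₁,γ₂)} f(γ₁) g(γ₂)`. -/
def mulQ {n : ℕ} (Q : Quiv n) (f g : AQ n) : AQ n := fun γ =>
  ∑ γ₁ ∈ Finset.Iic γ,
    tq ^ (Q.lam (toZ γ₁) (toZ (γ - γ₁))) * f γ₁ * g (γ - γ₁)

/-- Ordered product of a list of elements of `Â_Q`. -/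
def prodQ {n : ℕ} (Q : Quiv n) (L : List (AQ n)) : AQ n := L.foldr (mulQ Q) oneQ

/-- Power in the quantum algebra. -/
def powQ {n : ℕ} (Q : Quiv n) (f : AQ n) : ℕ → AQ n
  | 0 => oneQ
  | k + 1 => mulQ Q f (powQ Q f k)

/-- `P_k = Π_{j=1}^k (1 − q^j)⁻¹` with `q = t²`, the Poincaré series of
`H^*(BGL(k,ℂ))`. -/
def Pq (k : ℕ) : RatFunc ℚ := ∏ j ∈ Finset.Icc 1 k, (1 - tq ^ (2 * j))⁻¹

/-- The quantum dilogarithm `E(y_γ) = 1 + Σ_{k≥1} (−1)^k t^{k²} P_k y_γ^k`,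
written out as the function supported on the multiples `k • γ`,
with value `t^{k²} P_k` at `k • γ`  (note `y_γ^k = (−1)^k δ_{kγ}`). -/
def Edl {n : ℕ} (γ : Fin n → ℕ) : AQ n := fun δ =>
  ∑ k ∈ Finset.range ((∑ i, δ i) + 1),
    if δ = k • γ then tq ^ (k ^ 2) * Pq k else 0

end

/-- `2c_m = Σ_{u<v} m_u m_v λ(φ_u,φ_v) − Σ_{i<i'} γ(i)γ(i') λ(e_i,e_{i'})
− Σ_i γ(i)² + Σ_u m_u²` (twice the complex codimension of `η_m`). -/
def c2Exp {n r : ℕ} (Q : Quiv n) (φ : Fin r → (Fin n → ℕ)) (μ : Fin r → ℕ)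
    (γ : Fin n → ℕ) : ℤ :=
  (∑ u : Fin r, ∑ v : Fin r, if u < v then
      (μ u : ℤ) * (μ v : ℤ) * Q.lam (Quiv.toZ (φ u)) (Quiv.toZ (φ v)) else 0) -
  (∑ i : Fin n, ∑ i' : Fin n, if i < i' then
      (γ i : ℤ) * (γ i' : ℤ) *
        Q.lam (Quiv.toZ (Pi.single i 1)) (Quiv.toZ (Pi.single i' 1)) else 0) -
  (∑ i : Fin n, (γ i : ℤ) ^ 2) + ∑ u : Fin r, (μ u : ℤ) ^ 2


namespace KZ

section qstuff
variable {K : Type*} [Field K]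

/-- `P_k` for a general `q`. -/
noncomputable def PP (q : K) (k : ℕ) : K := ∏ j ∈ Finset.Icc 1 k, (1 - q ^ j)⁻¹

lemma PP_zero (q : K) : PP q 0 = 1 := by simp [PP]

lemma PP_succ (q : K) (k : ℕ) : PP q (k+1) = PP q k * (1 - q ^ (k+1))⁻¹ := by
  unfold PP
  rw [Finset.prod_Icc_succ_top (by omega)]

lemma PP_ne (q : K) (hq : ∀ k : ℕ, 1 ≤ k → q ^ k ≠ 1) (k : ℕ) : PP q k ≠ 0 := by
  unfold PP
  refine Finset.prod_ne_zero_iff.2 fun j hj => inv_ne_zero (sub_ne_zero.2 ?_)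
  exact (hq j (Finset.mem_Icc.1 hj).1).symm

/-- Gaussian binomial. -/
noncomputable def gb (q : K) (N m : ℕ) : K :=
  if m ≤ N then PP q m * PP q (N - m) / PP q N else 0

lemma gb_zero (q : K) (hq : ∀ k : ℕ, 1 ≤ k → q ^ k ≠ 1) (N : ℕ) : gb q N 0 = 1 := by
  simp [gb, PP_zero, PP_ne q hq]

lemma gb_pascal (q : K) (hq : ∀ k : ℕ, 1 ≤ k → q ^ k ≠ 1) (N m : ℕ) :
    gb q (N+1) (m+1) = q ^ (m+1) * gb q N (m+1) + gb q N m := by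
  have h1 : ∀ k : ℕ, (1 - q ^ (k+1)) ≠ 0 := fun k => sub_ne_zero.2 (hq (k+1) (by omega)).symm
  rcases lt_trichotomy m N with h | h | h
  · obtain ⟨d, rfl⟩ : ∃ d, N = m + 1 + d := ⟨N - m - 1, by omega⟩
    have e1 : m + 1 + d + 1 - (m + 1) = d + 1 := by omega
    have e2 : m + 1 + d - (m+1) = d := by omega
    have e3 : m + 1 + d - m = d + 1 := by omega
    unfold gb
    rw [if_pos (by omega), if_pos (by omega), if_pos (by omega), e1, e2, e3,
      PP_succ q d, PP_succ q m, PP_succ q (m+1+d)]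
    have a1 := h1 d
    have a2 := h1 m
    have a3 := h1 (m+1+d)
    have a4 := PP_ne q hq (m+1+d)
    field_simp
    ring
  · subst h
    unfold gb
    have a4 := PP_ne q hq m
    have a5 := PP_ne q hq (m+1)
    simp [PP_zero, a4, a5]
  · unfold gb
    rw [if_neg (by omega), if_neg (by omega), if_neg (by omega)]
    simp

lemma gb_symm (q : K) {N m : ℕ} (h : m ≤ N) : gb q N (N - m) = gb q N m := by
  unfold gb
  rw [if_pos h, if_pos (by omega), Nat.sub_sub_self h, mul_comm]

lemma gb_sum_aux (q : K) (hq : ∀ k : ℕ, 1 ≤ k → q ^ k ≠ 1) (N d : ℕ) :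
    ∑ m ∈ Finset.range (d+1), q ^ ((d-m)*(N-m)) * PP q (d - m) * gb q N m = PP q d := by
  induction N generalizing d with
  | zero =>
    rw [Finset.sum_eq_single_of_mem 0 (by simp)]
    · simp [gb_zero q hq]
    · intro b _ hb
      simp [gb, hb]
  | succ N ih =>
    cases d with
    | zero => simp [gb_zero q hq, PP_zero]
    | succ d =>
      rw [Finset.sum_range_succ']
      have ih1 := ih (d+1)
      rw [Finset.sum_range_succ'] at ih1
      have ih2 := ih d
      have key : ∀ m ∈ Finset.range (d+1),
          q ^ ((d + 1 - (m + 1)) * (N + 1 - (m + 1))) * PP q (d + 1 - (m + 1)) * gb q (N + 1) (m + 1)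
          = q ^ (d+1) * (q ^ ((d+1 - (m+1)) * (N - (m+1))) * PP q (d+1 - (m+1)) * gb q N (m+1))
            + q ^ ((d-m)*(N-m)) * PP q (d - m) * gb q N m := by
        intro m hm
        have hm : m ≤ d := by simpa [Nat.lt_succ_iff] using hm
        rw [gb_pascal q hq]
        simp only [Nat.add_sub_add_right]
        by_cases h : m + 1 ≤ N
        · obtain ⟨c, rfl⟩ : ∃ c, N = m + 1 + c := ⟨N - m - 1, by omega⟩
          obtain ⟨b, rfl⟩ : ∃ b, d = m + b := ⟨d - m, by omega⟩
          have e1 : m + 1 + c - m = c + 1 := by omega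
          have e2 : m + b - m = b := by omega
          have e3 : m + 1 + c - (m+1) = c := by omega
          rw [e1, e2, e3]
          ring
        · have : gb q N (m+1) = 0 := by simp [gb, h]
          rw [this]; ring
      rw [Finset.sum_congr rfl key, Finset.sum_add_distrib, ih2, ← Finset.mul_sum]
      have h1 : (1 - q ^ (d+1)) ≠ 0 := sub_ne_zero.2 (hq (d+1) (by omega)).symm
      have h2 : PP q d = PP q (d+1) * (1 - q ^ (d+1)) := by
        rw [PP_succ]; field_simp
      simp only [gb_zero q hq, Nat.sub_zero, mul_one] at ih1 ⊢
      rw [h2]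
      have e : q ^ ((d+1)*(N+1)) = q ^ (d+1) * q ^ ((d+1)*N) := by ring
      rw [e]
      linear_combination (q ^ (d+1)) * ih1

lemma gb_sum (q : K) (hq : ∀ k : ℕ, 1 ≤ k → q ^ k ≠ 1) (N d : ℕ) :
    ∑ k ∈ Finset.range (d+1), q ^ ((k:ℤ) * ((N:ℤ) + k - d)) * PP q k * gb q N (d-k) = PP q d := by
  rw [← gb_sum_aux q hq N d, ← Finset.sum_range_reflect]
  refine Finset.sum_congr rfl fun k hk => ?_
  have hk : k ≤ d := by simpa [Nat.lt_succ_iff] using hk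
  have e : d + 1 - 1 - k = d - k := by omega
  rw [e, Nat.sub_sub_self hk]
  by_cases h : k ≤ N
  · congr 2
    rw [← zpow_natCast]
    congr 1
    push_cast [hk, h]
    ring
  · have : gb q N k = 0 := by simp [gb, h]
    rw [this]; simp

end qstuff

section ops
variable {I : Type*} [Fintype I] {K : Type*} [Field K]

abbrev Form (I : Type*) := LinearMap.BilinForm ℤ (I → ℤ)

/-- sum of positive parts of the coordinates -/
def ht (γ : I → ℤ) : ℕ := ∑ i, (γ i).toNat

/-- vanishes off the nonnegative cone -/
def NN (T : (I → ℤ) → K) : Prop := ∀ γ, ¬ 0 ≤ γ → T γ = 0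

/-- left multiplication by the dilogarithm of `β` for the form `B` -/
noncomputable def Lop (q : K) (B : Form I) (β : I → ℤ) (T : (I → ℤ) → K) : (I → ℤ) → K :=
  fun γ => ∑ k ∈ Finset.range (ht γ + 1),
    q ^ (-(B ((k:ℤ) • β) (γ - (k:ℤ) • β))) * PP q k * T (γ - (k:ℤ) • β)

lemma ht_mono {γ δ : I → ℤ} (h : γ ≤ δ) : ht γ ≤ ht δ :=
  Finset.sum_le_sum fun i _ => Int.toNat_le_toNat (h i)

lemma exists_pos {β : I → ℤ} (h0 : 0 ≤ β) (hne : β ≠ 0) : ∃ i, 1 ≤ β i := by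
  by_contra! h
  apply hne
  funext i
  have := h i
  have := h0 i
  simp at *
  omega

lemma ht_lt {β : I → ℤ} (h0 : 0 ≤ β) (hne : β ≠ 0) {γ : I → ℤ} {k : ℕ}
    (hk : 0 ≤ γ - (k:ℤ) • β) (hk1 : 1 ≤ k) : ht (γ - (k:ℤ) • β) < ht γ := by
  obtain ⟨i, hi⟩ := exists_pos h0 hne
  refine Finset.sum_lt_sum (fun i _ => Int.toNat_le_toNat ?_) ⟨i, Finset.mem_univ _, ?_⟩
  · have := h0 i
    simp only [Pi.sub_apply, Pi.smul_apply, smul_eq_mul, Pi.zero_apply] at *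
    nlinarith
  · have := hk i
    have hkz : (1:ℤ) ≤ k := by exact_mod_cast hk1
    simp only [Pi.sub_apply, Pi.smul_apply, smul_eq_mul, Pi.zero_apply] at *
    have : 1 ≤ (k:ℤ) * β i := by nlinarith
    omega

lemma le_ht {β : I → ℤ} (h0 : 0 ≤ β) (hne : β ≠ 0) {γ : I → ℤ} {k : ℕ}
    (hk : 0 ≤ γ - (k:ℤ) • β) : k ≤ ht γ := by
  obtain ⟨i, hi⟩ := exists_pos h0 hne
  have h1 : (γ i).toNat ≤ ht γ :=
    Finset.single_le_sum (f := fun i => (γ i).toNat) (fun i _ => Nat.zero_le _) (Finset.mem_univ i)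
  have := hk i
  simp only [Pi.sub_apply, Pi.smul_apply, smul_eq_mul, Pi.zero_apply] at *
  have : (k:ℤ) ≤ (k:ℤ) * β i := by nlinarith
  omega

lemma Lop_eq (q : K) (B : Form I) {β : I → ℤ} (h0 : 0 ≤ β) (hne : β ≠ 0)
    {T : (I → ℤ) → K} (hT : NN T) (γ : I → ℤ) {N : ℕ} (hN : ht γ < N) :
    Lop q B β T γ = ∑ k ∈ Finset.range N,
      q ^ (-(B ((k:ℤ) • β) (γ - (k:ℤ) • β))) * PP q k * T (γ - (k:ℤ) • β) := by
  unfold Lop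
  refine Finset.sum_subset (fun k hk => ?_) (fun k _ hk => ?_)
  · simp only [Finset.mem_range] at *; omega
  · rw [hT, mul_zero]
    intro h
    apply hk
    have := le_ht h0 hne h
    simp only [Finset.mem_range]; omega

lemma Lop_NN (q : K) (B : Form I) {β : I → ℤ} (h0 : 0 ≤ β) 
    {T : (I → ℤ) → K} (hT : NN T) : NN (Lop q B β T) := by
  intro γ hγ
  refine Finset.sum_eq_zero fun k _ => ?_
  rw [hT, mul_zero]
  intro h
  apply hγ
  intro i
  have := h i
  have := h0 i
  simp only [Pi.sub_apply, Pi.smul_apply, smul_eq_mul, Pi.zero_apply] at *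
  nlinarith

lemma Lop_split (q : K) (B : Form I) (β : I → ℤ) (T : (I → ℤ) → K) (γ : I → ℤ) :
    Lop q B β T γ = (∑ k ∈ Finset.range (ht γ),
      q ^ (-(B (((k+1:ℕ):ℤ) • β) (γ - ((k+1:ℕ):ℤ) • β))) * PP q (k+1) * T (γ - ((k+1:ℕ):ℤ) • β))
      + T γ := by
  unfold Lop
  rw [Finset.sum_range_succ']
  simp [PP_zero]

/-- If two functions agree after `Lop` off `S`, they agree off `S`. -/
lemma Lop_inj (q : K) (B : Form I) {β : I → ℤ} (h0 : 0 ≤ β) (hne : β ≠ 0)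
    {T₁ T₂ : (I → ℤ) → K} (h₁ : NN T₁) (h₂ : NN T₂) (S : Set (I → ℤ))
    (hS : ∀ γ ∈ S, γ + β ∈ S) (h : ∀ γ, γ ∉ S → Lop q B β T₁ γ = Lop q B β T₂ γ) :
    ∀ γ, γ ∉ S → T₁ γ = T₂ γ := by
  have hS' : ∀ (k : ℕ) γ, γ - (k:ℤ) • β ∈ S → γ ∈ S := by
    intro k
    induction k with
    | zero => intro γ h; simpa using h
    | succ k ih =>
      intro γ h
      apply ih
      have := hS _ h
      convert this using 1
      push_cast
      module
  intro γ
  induction hn : ht γ using Nat.strong_induction_on generalizing γ with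
  | _ n ih =>
    intro hγ
    have e := h γ hγ
    rw [Lop_split, Lop_split] at e
    have e2 : ∀ k ∈ Finset.range (ht γ),
      q ^ (-(B (((k+1:ℕ):ℤ) • β) (γ - ((k+1:ℕ):ℤ) • β))) * PP q (k+1) * T₁ (γ - ((k+1:ℕ):ℤ) • β)
      = q ^ (-(B (((k+1:ℕ):ℤ) • β) (γ - ((k+1:ℕ):ℤ) • β))) * PP q (k+1)
        * T₂ (γ - ((k+1:ℕ):ℤ) • β) := by
      intro k _
      congr 1
      by_cases hp : 0 ≤ γ - ((k+1:ℕ):ℤ) • β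
      · exact ih _ (hn ▸ ht_lt h0 hne hp (by omega)) _ rfl (fun hc => hγ (hS' _ _ hc))
      · rw [h₁ _ hp, h₂ _ hp]
    rw [Finset.sum_congr rfl e2] at e
    exact add_left_cancel e

open Classical in
/-- recursive solution of `Lop f = g`, with fuel -/
noncomputable def Linv (q : K) (B : Form I) (β : I → ℤ) (g : (I → ℤ) → K) :
    ℕ → (I → ℤ) → K
  | 0 => fun γ => if 0 ≤ γ then g γ else 0
  | m + 1 => fun γ => if 0 ≤ γ then g γ - ∑ k ∈ Finset.range (ht γ),
      q ^ (-(B (((k+1:ℕ):ℤ) • β) (γ - ((k+1:ℕ):ℤ) • β))) * PP q (k+1)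
        * Linv q B β g m (γ - ((k+1:ℕ):ℤ) • β) else 0

lemma Linv_NN (q : K) (B : Form I) (β : I → ℤ) (g : (I → ℤ) → K) (m : ℕ) :
    NN (Linv q B β g m) := by
  intro γ hγ
  cases m <;> simp [Linv, hγ]

lemma Linv_stab (q : K) (B : Form I) {β : I → ℤ} (h0 : 0 ≤ β) (hne : β ≠ 0)
    (g : (I → ℤ) → K) (m : ℕ) : ∀ γ, ht γ ≤ m → Linv q B β g m γ = Linv q B β g (ht γ) γ := by
  induction m using Nat.strong_induction_on with
  | _ m ih =>
  intro γ hγ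
  by_cases hp : 0 ≤ γ
  swap
  · rw [Linv_NN _ _ _ _ _ _ hp, Linv_NN _ _ _ _ _ _ hp]
  rcases hγ.eq_or_lt with h | h
  · rw [h]
  cases m with
  | zero => omega
  | succ m =>
    cases hh : ht γ with
    | zero => simp [Linv, hp, hh]
    | succ l =>
      simp only [Linv, hp, if_true]
      congr 1
      refine Finset.sum_congr rfl fun k _ => ?_
      congr 1
      by_cases hp' : 0 ≤ γ - ((k+1:ℕ):ℤ) • β
      · have := ht_lt h0 hne hp' (by omega)
        rw [ih m (by omega) _ (by omega), ih l (by omega) _ (by omega)]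
      · rw [Linv_NN _ _ _ _ _ _ hp', Linv_NN _ _ _ _ _ _ hp']

lemma Lop_surj (q : K) (B : Form I) {β : I → ℤ} (h0 : 0 ≤ β) (hne : β ≠ 0)
    (g : (I → ℤ) → K) (hg : NN g) : ∃ f, NN f ∧ Lop q B β f = g := by
  have hNN : NN (fun γ => Linv q B β g (ht γ) γ) := fun γ hγ => Linv_NN _ _ _ _ _ _ hγ
  refine ⟨fun γ => Linv q B β g (ht γ) γ, hNN, ?_⟩
  funext γ
  by_cases hp : 0 ≤ γ
  swap
  · rw [hg γ hp, Lop_NN q B h0 hNN γ hp]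
  rw [Lop_split]
  cases hh : ht γ with
  | zero => simp [Linv, hp]
  | succ l =>
    simp only [Linv, hp, if_true, hh]
    rw [← add_sub_assoc, sub_eq_iff_eq_add, add_comm]
    congr 1
    refine Finset.sum_congr rfl fun k _ => ?_
    congr 1
    by_cases hp' : 0 ≤ γ - ((k+1:ℕ):ℤ) • β
    · have := ht_lt h0 hne hp' (by omega)
      rw [Linv_stab q B h0 hne g l _ (by omega)]
    · rw [Linv_NN _ _ _ _ _ _ hp', Linv_NN _ _ _ _ _ _ hp']

lemma Lop_comm (q : K) (hq0 : q ≠ 0) (B : Form I) {β ε : I → ℤ} (h0 : 0 ≤ β) (hne : β ≠ 0)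
    (g0 : 0 ≤ ε) (gne : ε ≠ 0) {T : (I → ℤ) → K} (hT : NN T) :
    Lop q B β (Lop q B.flip ε T) = Lop q B.flip ε (Lop q B β T) := by
  funext γ
  have hle : ∀ {x : I → ℤ} (_ : 0 ≤ x) (k : ℕ), ht (γ - (k:ℤ) • x) ≤ ht γ := by
    intro x hx k
    apply ht_mono
    intro i
    have := hx i
    simp only [Pi.sub_apply, Pi.smul_apply, smul_eq_mul, Pi.zero_apply] at *
    nlinarith
  rw [Lop_eq q B h0 hne (Lop_NN q B.flip g0 hT) γ (Nat.lt_succ_self _),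
    Lop_eq q B.flip g0 gne (Lop_NN q B h0 hT) γ (Nat.lt_succ_self _)]
  have e1 : ∀ k : ℕ, Lop q B.flip ε T (γ - (k:ℤ) • β) = _ := fun k =>
    Lop_eq q B.flip g0 gne hT (γ - (k:ℤ) • β) (N := (ht γ).succ) (Nat.lt_succ_of_le (hle h0 k))
  have e2 : ∀ k : ℕ, Lop q B β T (γ - (k:ℤ) • ε) = _ := fun k =>
    Lop_eq q B h0 hne hT (γ - (k:ℤ) • ε) (N := (ht γ).succ) (Nat.lt_succ_of_le (hle g0 k))
  simp only [e1, e2, Finset.mul_sum]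
  rw [Finset.sum_comm]
  refine Finset.sum_congr rfl fun l _ => Finset.sum_congr rfl fun k _ => ?_
  rw [sub_right_comm γ ((l:ℤ) • ε)]
  have : ∀ (a b c d x y z : K), a * b = c * d → a * x * (b * y * z) = c * y * (d * x * z) := by
    intro a b c d x y z h
    linear_combination x * y * z * h
  apply this
  rw [← zpow_add₀ hq0, ← zpow_add₀ hq0]
  congr 1
  simp only [LinearMap.BilinForm.flip_apply, map_sub, map_smul, LinearMap.smul_apply, smul_eq_mul]
  ring

end ops
end KZ

namespace KZ
set_option linter.unusedSectionVars false
set_option linter.unusedSimpArgs false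

section refl
variable {I : Type*} [Fintype I] [DecidableEq I]

/-- simple root -/
def ee (j : I) : I → ℤ := Pi.single j 1

structure Good (B : Form I) : Prop where
  diag : ∀ i, B (ee i) (ee i) = 1
  off : ∀ i k, i ≠ k → B (ee i) (ee k) ≤ 0
  pos : ∀ x, x ≠ 0 → 0 < B x x

def IsRt (B : Form I) (β : I → ℤ) : Prop := 0 ≤ β ∧ B β β = 1

structure Adm (B : Form I) (L : List (I → ℤ)) : Prop where
  nodup : L.Nodup
  roots : ∀ β, β ∈ L ↔ IsRt B β
  ord : L.Pairwise (fun a b => B a b ≤ B b a)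

/-- reflection -/
def sr (B : Form I) (j : I) : (I → ℤ) →ₗ[ℤ] (I → ℤ) :=
  LinearMap.id - (B.flip (ee j) + B (ee j)).smulRight (ee j)

def rB (B : Form I) (j : I) : Form I := B.compl₁₂ (sr B j) (sr B j)

lemma sr_apply (B : Form I) (j : I) (x : I → ℤ) :
    sr B j x = x - (B x (ee j) + B (ee j) x) • ee j := by
  simp [sr]

lemma rB_apply (B : Form I) (j : I) (x y : I → ℤ) :
    rB B j x y = B (sr B j x) (sr B j y) := rfl

lemma sr_sr {B : Form I} (hB : Good B) (j : I) (x : I → ℤ) : sr B j (sr B j x) = x := by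
  simp only [sr_apply, map_sub, map_smul, LinearMap.sub_apply, LinearMap.smul_apply, hB.diag,
    smul_eq_mul]
  module

lemma ee_self (j : I) : ee j j = 1 := by simp [ee]
lemma ee_ne {i j : I} (h : i ≠ j) : ee j i = 0 := by simp [ee, h]
lemma ee_nonneg (j : I) : 0 ≤ ee j := by
  intro i
  by_cases h : i = j
  · subst h; simp [ee_self]
  · simp [ee_ne h]
lemma ee_ne_zero (j : I) : ee j ≠ 0 := fun h => by
  have := congrFun h j
  simp [ee_self] at this

lemma sr_self {B : Form I} (hB : Good B) (j : I) : sr B j (ee j) = - ee j := by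
  rw [sr_apply, hB.diag]; module

lemma sr_ne (B : Form I) {i j : I} (h : i ≠ j) (x : I → ℤ) : sr B j x i = x i := by
  simp [sr_apply, ee_ne h]

lemma sum_ee (x : I → ℤ) : x = ∑ i, x i • ee i := by
  funext k
  simp [ee, Finset.sum_apply, Pi.single_apply]

lemma expand_right (B : Form I) (x y : I → ℤ) : B y x = ∑ i, x i * B y (ee i) := by
  conv_lhs => rw [sum_ee x]
  simp only [map_sum, map_smul, smul_eq_mul]

lemma expand_left (B : Form I) (x y : I → ℤ) : B x y = ∑ i, x i * B (ee i) y := by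
  conv_lhs => rw [sum_ee x]
  simp only [map_sum, map_smul, LinearMap.sum_apply, LinearMap.smul_apply, smul_eq_mul]

lemma src_right {B : Form I} (hB : Good B) {j : I} (hj : ∀ i, i ≠ j → B (ee i) (ee j) = 0)
    (x : I → ℤ) : B x (ee j) = x j := by
  rw [expand_left, Finset.sum_eq_single j]
  · simp [hB.diag]
  · intro i _ hi; simp [hj i hi]
  · simp

lemma sr_at {B : Form I} (hB : Good B) {j : I} (hj : ∀ i, i ≠ j → B (ee i) (ee j) = 0)
    (x : I → ℤ) : sr B j x j = - B (ee j) x := by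
  simp [sr_apply, ee_self, src_right hB hj]

lemma rB_sr {B : Form I} (hB : Good B) (j : I) (x y : I → ℤ) :
    rB B j (sr B j x) (sr B j y) = B x y := by
  rw [rB_apply, sr_sr hB, sr_sr hB]

/-- a root is nonnegative or nonpositive -/
lemma root_sign {B : Form I} (hB : Good B) {x : I → ℤ} (hx : B x x = 1) {i : I} (hi : 0 < x i) :
    0 ≤ x := by
  set p : I → ℤ := fun i => max (x i) 0 with hp
  set m : I → ℤ := fun i => max (-x i) 0 with hm
  have hxe : x = p - m := by
    funext i; simp only [hp, hm, Pi.sub_apply]; omega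
  have hp0 : p ≠ 0 := fun h => by
    have := congrFun h i
    simp only [hp, Pi.zero_apply] at this; omega
  have cross : ∀ a b : I → ℤ, (∀ i, 0 ≤ a i) → (∀ i, 0 ≤ b i) → (∀ i, a i * b i = 0) →
      B a b ≤ 0 := by
    intro a b ha hb hab
    rw [expand_left]
    refine Finset.sum_nonpos fun i _ => ?_
    rw [expand_right, Finset.mul_sum]
    refine Finset.sum_nonpos fun k _ => ?_
    by_cases hik : i = k
    · subst hik; rw [← mul_assoc, hab]; simp
    · have := hB.off i k hik
      have := mul_nonneg (ha i) (hb k)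
      nlinarith
  have c1 : B p m ≤ 0 := cross p m (fun i => le_max_right _ _) (fun i => le_max_right _ _)
    (fun i => by
      simp only [hp, hm]
      rcases le_total (x i) 0 with h | h
      · rw [max_eq_right h]; simp
      · rw [max_eq_right (a := -x i) (by omega)]; simp)
  have c2 : B m p ≤ 0 := cross m p (fun i => le_max_right _ _) (fun i => le_max_right _ _)
    (fun i => by
      simp only [hp, hm]
      rcases le_total (x i) 0 with h | h
      · rw [max_eq_right h]; simp
      · rw [max_eq_right (a := -x i) (by omega)]; simp)
  have c3 := hB.pos p hp0
  by_cases hm0 : m = 0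
  · intro k
    have := congrFun hm0 k
    simp only [hm, Pi.zero_apply] at this ⊢; omega
  · have c4 := hB.pos m hm0
    rw [hxe] at hx
    simp only [map_sub, LinearMap.sub_apply] at hx
    omega

lemma rt_ne_zero {B : Form I} {β : I → ℤ} (h : IsRt B β) : β ≠ 0 := fun h0 => by
  have := h.2
  simp [h0] at this

lemma ee_rt {B : Form I} (hB : Good B) (j : I) : IsRt B (ee j) := ⟨ee_nonneg j, hB.diag j⟩

lemma sr_rt {B : Form I} (hB : Good B) (C : Form I) {j : I} {β : I → ℤ} (hb : IsRt C β)
    (hC : Good C) (hne : β ≠ ee j)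
    (h1 : B (sr B j β) (sr B j β) = 1) : 0 ≤ sr B j β := by
  have : ∃ i, i ≠ j ∧ 0 < β i := by
    by_contra! h
    have hz : ∀ i, i ≠ j → β i = 0 := fun i hi => le_antisymm (h i hi) (hb.1 i)
    have hβ : β = (β j) • ee j := by
      funext i
      by_cases hi : i = j
      · subst hi; simp [ee_self]
      · simp [ee_ne hi, hz i hi]
    have h2 := hb.2
    rw [hβ] at h2
    simp only [map_smul, LinearMap.smul_apply, hC.diag, smul_eq_mul, mul_one] at h2
    have h3 := hb.1 j
    simp only [Pi.zero_apply] at h3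
    have : β j = 1 := by nlinarith
    apply hne
    rw [hβ, this, one_smul]
  obtain ⟨i, hi, hpos⟩ := this
  refine root_sign hB h1 (i := i) ?_
  rwa [sr_ne B hi]

lemma rB_good {B : Form I} (hB : Good B) {j : I} (hj : ∀ i, i ≠ j → B (ee i) (ee j) = 0) :
    Good (rB B j) := by
  have hs : ∀ i, i ≠ j → sr B j (ee i) = ee i - (B (ee j) (ee i)) • ee j := by
    intro i hi
    rw [sr_apply, hj i hi]; simp
  have hcomp : ∀ i k, i ≠ j → k ≠ j → rB B j (ee i) (ee k) = B (ee i) (ee k) := by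
    intro i k hi hk
    rw [rB_apply, hs i hi, hs k hk]
    simp only [map_sub, map_smul, LinearMap.sub_apply, LinearMap.smul_apply, hB.diag, hj i hi,
      smul_eq_mul]
    ring
  refine ⟨fun i => ?_, fun i k hik => ?_, fun x hx => ?_⟩
  · by_cases hi : i = j
    · subst hi; rw [rB_apply, sr_self hB]; simp [hB.diag]
    · rw [hcomp i i hi hi, hB.diag]
  · by_cases hi : i = j
    · subst hi
      rw [rB_apply, sr_self hB, hs k (Ne.symm hik)]
      simp only [map_sub, map_neg, map_smul, LinearMap.neg_apply, hB.diag, smul_eq_mul]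
      linarith
    · by_cases hk : k = j
      · subst hk
        rw [rB_apply, sr_self hB, hs i hi]
        simp only [map_sub, map_neg, map_smul, LinearMap.sub_apply, LinearMap.smul_apply, hB.diag,
          hj i hi, smul_eq_mul]
        have := hB.off k i (Ne.symm hik)
        linarith
      · rw [hcomp i k hi hk]; exact hB.off i k hik
  · rw [rB_apply]
    apply hB.pos
    intro h
    apply hx
    rw [← sr_sr hB j x, h, map_zero]

lemma adm_head {B : Form I} (hB : Good B) {β : I → ℤ} {L : List (I → ℤ)} (h : Adm B (β :: L)) :
    ∃ j, β = ee j ∧ ∀ i, i ≠ j → B (ee i) (ee j) = 0 := by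
  have hβ : IsRt B β := (h.roots β).1 (by simp)
  have hle : ∀ x, IsRt B x → B β x ≤ B x β := by
    intro x hx
    have := (h.roots x).2 hx
    rcases List.mem_cons.1 this with rfl | hm
    · exact le_rfl
    · exact (List.pairwise_cons.1 h.ord).1 x hm
  have hle' : ∀ k, B β (ee k) ≤ B (ee k) β := fun k => hle _ (ee_rt hB k)
  have s1 : ∑ k, β k * (B (ee k) β - B β (ee k)) = 0 := by
    simp only [mul_sub, Finset.sum_sub_distrib]
    rw [← expand_left, ← expand_right]; simp
  have s2 : ∀ k, β k * (B (ee k) β - B β (ee k)) = 0 := by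
    intro k
    refine (Finset.sum_eq_zero_iff_of_nonneg ?_).1 s1 k (Finset.mem_univ k)
    intro i _
    exact mul_nonneg (hβ.1 i) (sub_nonneg.2 (hle' i))
  have s3 : ∃ k, 0 < β k * B β (ee k) := by
    by_contra! hc
    have := expand_right B β β
    rw [hβ.2] at this
    have := Finset.sum_nonpos (fun k (_ : k ∈ Finset.univ) => hc k)
    omega
  obtain ⟨j, hj⟩ := s3
  have hbj : 0 ≤ β j := hβ.1 j
  have hbj' : 0 < β j := lt_of_le_of_ne hbj (fun h => by rw [← h] at hj; simp at hj)
  have hc : 1 ≤ B β (ee j) := by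
    by_contra! hc
    nlinarith
  have heq : B (ee j) β = B β (ee j) := by
    rcases mul_eq_zero.1 (s2 j) with h | h <;> omega
  have hbe : β = ee j := by
    by_contra hne
    have := hB.pos (β - ee j) (sub_ne_zero.2 hne)
    simp only [map_sub, LinearMap.sub_apply, hB.diag, hβ.2, heq] at this
    omega
  refine ⟨j, hbe, fun i hi => ?_⟩
  subst hbe
  have h1 := hle' i
  have h2 := hB.off i j hi
  have h3 := hB.off j i (Ne.symm hi)
  have h4 := hB.pos (ee i + ee j) (fun h => by
    have := congrFun h j
    simp [ee_self, ee_ne (Ne.symm hi)] at this)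
  simp only [map_add, LinearMap.add_apply, hB.diag] at h4
  omega

lemma adm_step {B : Form I} (hB : Good B) {j : I} {L : List (I → ℤ)} (h : Adm B (ee j :: L))
    (hj : ∀ i, i ≠ j → B (ee i) (ee j) = 0) :
    Adm (rB B j) (L.map (sr B j) ++ [ee j]) := by
  have hB' := rB_good hB hj
  have hinj : Function.Injective (sr B j) := Function.LeftInverse.injective (g := sr B j) (sr_sr hB j)
  have hnot : ee j ∉ L := (List.nodup_cons.1 h.nodup).1
  have hLroot : ∀ x ∈ L, IsRt B x := fun x hx => (h.roots x).1 (by simp [hx])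
  have hjnot : ∀ x ∈ L, sr B j x ≠ ee j := by
    intro x hx hc
    have h1 := congrArg (sr B j) hc
    rw [sr_sr hB, sr_self hB] at h1
    have h2 := (hLroot x hx).1 j
    rw [h1] at h2
    simp [ee_self] at h2
  refine ⟨?_, fun β => ⟨fun hβ => ?_, fun hβ => ?_⟩, ?_⟩
  · rw [List.nodup_append]
    refine ⟨(List.nodup_cons.1 h.nodup).2.map hinj, by simp, ?_⟩
    intro a ha b hb
    obtain ⟨x, hx, rfl⟩ := List.mem_map.1 ha
    simp only [List.mem_singleton] at hb
    subst hb
    exact hjnot x hx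
  · rcases List.mem_append.1 hβ with hβ | hβ
    · obtain ⟨x, hx, rfl⟩ := List.mem_map.1 hβ
      have hr := hLroot x hx
      have hxe : x ≠ ee j := fun hc => hnot (hc ▸ hx)
      have hn : rB B j (sr B j x) (sr B j x) = 1 := by rw [rB_sr hB]; exact hr.2
      refine ⟨?_, hn⟩
      -- nonnegativity
      have : ∃ i, i ≠ j ∧ 0 < x i := by
        by_contra! hh
        have hz : ∀ i, i ≠ j → x i = 0 := fun i hi => le_antisymm (hh i hi) (hr.1 i)
        have hβ : x = (x j) • ee j := by
          funext i
          by_cases hi : i = j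
          · subst hi; simp [ee_self]
          · simp [ee_ne hi, hz i hi]
        have h2 := hr.2
        rw [hβ] at h2
        simp only [map_smul, LinearMap.smul_apply, hB.diag, smul_eq_mul, mul_one] at h2
        have h3 := hr.1 j
        simp only [Pi.zero_apply] at h3
        have : x j = 1 := by nlinarith
        apply hxe
        rw [hβ, this, one_smul]
      obtain ⟨i, hi, hpos⟩ := this
      refine root_sign hB' hn (i := i) ?_
      rwa [sr_ne B hi]
    · simp only [List.mem_singleton] at hβ
      subst hβ
      exact ee_rt hB' j
  · by_cases hb : β = ee j
    · simp [hb]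
    · have h1 : B (sr B j β) (sr B j β) = 1 := hβ.2
      have h2 := sr_rt hB (rB B j) hβ hB' hb h1
      have h3 := (h.roots (sr B j β)).2 ⟨h2, h1⟩
      rcases List.mem_cons.1 h3 with h4 | h4
      · have h5 := congrArg (sr B j) h4
        rw [sr_sr hB, sr_self hB] at h5
        have h6 := hβ.1 j
        rw [h5] at h6
        simp [ee_self] at h6
      · refine List.mem_append.2 (Or.inl (List.mem_map.2 ⟨_, h4, sr_sr hB j β⟩))
  · rw [List.pairwise_append]
    refine ⟨?_, by simp, ?_⟩
    · rw [List.pairwise_map]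
      refine (List.pairwise_cons.1 h.ord).2.imp ?_
      intro a b hab
      rw [rB_sr hB, rB_sr hB]; exact hab
    · intro a ha b hb
      obtain ⟨x, hx, rfl⟩ := List.mem_map.1 ha
      simp only [List.mem_singleton] at hb
      subst hb
      have h1 := (List.pairwise_cons.1 h.ord).1 x hx
      rw [rB_apply, rB_apply, sr_sr hB, sr_self hB]
      simpa using h1

end refl
end KZ

namespace KZ
set_option linter.unusedSectionVars false
set_option linter.unusedSimpArgs false

section main
variable {I : Type*} [Fintype I] [DecidableEq I] {K : Type*} [Field K]

open Classical in
noncomputable def GG (q : K) : (I → ℤ) → K := fun γ =>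
  if 0 ≤ γ then ∏ i, PP q (γ i).toNat else 0

open Classical in
noncomputable def HH (q : K) (N : (I → ℤ) →ₗ[ℤ] ℤ) (j : I) : (I → ℤ) → K := fun γ =>
  if 0 ≤ γ then (∏ i ∈ Finset.univ.erase j, PP q (γ i).toNat) * gb q (N γ).toNat (γ j).toNat else 0

lemma GG_NN (q : K) : NN (GG (I := I) q) := fun γ h => by simp [GG, h]
lemma HH_NN (q : K) (N : (I → ℤ) →ₗ[ℤ] ℤ) (j : I) : NN (HH q N j) := fun γ h => by simp [HH, h]

lemma Lop_HH (q : K) (hq : ∀ k : ℕ, 1 ≤ k → q ^ k ≠ 1) (C : Form I) (N : (I → ℤ) →ₗ[ℤ] ℤ) (j : I)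
    (hC : ∀ x, C (ee j) x = x j - N x) (hN0 : N (ee j) = 0) (hN : ∀ x, 0 ≤ x → 0 ≤ N x) :
    Lop q C (ee j) (HH q N j) = GG q := by
  funext γ
  by_cases hp : 0 ≤ γ
  swap
  · rw [GG_NN q γ hp, Lop_NN q C (ee_nonneg j) (HH_NN q N j) γ hp]
  have hd : ((γ j).toNat : ℤ) = γ j := Int.toNat_of_nonneg (hp j)
  have hNN : ((N γ).toNat : ℤ) = N γ := Int.toNat_of_nonneg (hN γ hp)
  have hle : (γ j).toNat ≤ ht γ :=
    Finset.single_le_sum (f := fun i => (γ i).toNat) (fun i _ => Nat.zero_le _) (Finset.mem_univ j)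
  have hcoord : ∀ k : ℕ, (γ - (k:ℤ) • ee j) j = γ j - k := by intro k; simp [ee_self]
  have hcoord' : ∀ (k : ℕ) i, i ≠ j → (γ - (k:ℤ) • ee j) i = γ i := by
    intro k i hi; simp [ee_ne hi]
  unfold Lop
  rw [← Finset.sum_subset (s₁ := Finset.range ((γ j).toNat + 1))]
  · have e : ∀ k ∈ Finset.range ((γ j).toNat + 1),
        q ^ (-(C ((k:ℤ) • ee j) (γ - (k:ℤ) • ee j))) * PP q k * HH q N j (γ - (k:ℤ) • ee j)
        = (∏ i ∈ Finset.univ.erase j, PP q (γ i).toNat) *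
          (q ^ ((k:ℤ) * (((N γ).toNat:ℤ) + k - ((γ j).toNat:ℤ))) * PP q k *
            gb q (N γ).toNat ((γ j).toNat - k)) := by
      intro k hk
      have hk : k ≤ (γ j).toNat := by simpa [Nat.lt_succ_iff] using hk
      have hpos : 0 ≤ γ - (k:ℤ) • ee j := by
        intro i
        by_cases hi : i = j
        · subst hi; rw [hcoord]; simp only [Pi.zero_apply]; omega
        · rw [hcoord' k i hi]; exact hp i
      have hNk : N (γ - (k:ℤ) • ee j) = N γ := by
        rw [map_sub, map_smul, hN0, smul_zero, sub_zero]
      have hcj : ((γ - (k:ℤ) • ee j) j).toNat = (γ j).toNat - k := by rw [hcoord]; omega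
      have hpr : ∏ i ∈ Finset.univ.erase j, PP q ((γ - (k:ℤ) • ee j) i).toNat
          = ∏ i ∈ Finset.univ.erase j, PP q (γ i).toNat :=
        Finset.prod_congr rfl fun i hi => by rw [hcoord' k i (Finset.ne_of_mem_erase hi)]
      have hexp : -(C ((k:ℤ) • ee j) (γ - (k:ℤ) • ee j))
          = (k:ℤ) * (((N γ).toNat:ℤ) + k - ((γ j).toNat:ℤ)) := by
        rw [map_smul, LinearMap.smul_apply, hC, hcoord, hNk, hNN, hd, smul_eq_mul]; ring
      rw [hexp]
      unfold HH
      rw [if_pos hpos, hNk, hcj, hpr]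
      ring
    rw [Finset.sum_congr rfl e, ← Finset.mul_sum, gb_sum q hq]
    unfold GG
    rw [if_pos hp, mul_comm, Finset.mul_prod_erase _ (fun i => PP q (γ i).toNat) (Finset.mem_univ j)]
  · intro k hk
    simp only [Finset.mem_range] at *; omega
  · intro k _ hk
    rw [HH_NN, mul_zero]
    intro h
    have := h j
    rw [hcoord] at this
    simp only [Pi.zero_apply, Finset.mem_range] at *
    omega

lemma HH_symm (q : K) (N : (I → ℤ) →ₗ[ℤ] ℤ) (j : I) (s : (I → ℤ) → (I → ℤ))
    (hs : ∀ x i, i ≠ j → s x i = x i) (hsj : ∀ x, s x j = N x - x j) (hNs : ∀ x, N (s x) = N x)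
    (hN : ∀ x : I → ℤ, (∀ i, i ≠ j → 0 ≤ x i) → 0 ≤ N x)
    (γ : I → ℤ) : HH q N j (s γ) = HH q N j γ := by
  have hpr : ∏ i ∈ Finset.univ.erase j, PP q (s γ i).toNat
          = ∏ i ∈ Finset.univ.erase j, PP q (γ i).toNat :=
        Finset.prod_congr rfl fun i hi => by rw [hs γ i (Finset.ne_of_mem_erase hi)]
  by_cases h1 : ∀ i, i ≠ j → 0 ≤ γ i
  swap
  · push Not at h1
    obtain ⟨i, hi, hneg⟩ := h1
    rw [HH_NN, HH_NN]
    · intro h; have := h i; simp only [Pi.zero_apply] at this; omega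
    · intro h; have := h i; rw [hs γ i hi] at this; simp only [Pi.zero_apply] at this; omega
  have p1 : 0 ≤ γ ↔ 0 ≤ γ j := by
    refine ⟨fun h => h j, fun h i => ?_⟩
    by_cases hi : i = j
    · subst hi; exact h
    · exact h1 i hi
  have p2 : 0 ≤ s γ ↔ 0 ≤ N γ - γ j := by
    refine ⟨fun h => hsj γ ▸ h j, fun h i => ?_⟩
    by_cases hi : i = j
    · subst hi; rw [hsj]; exact h
    · rw [hs γ i hi]; exact h1 i hi
  have hN' := hN γ h1
  unfold HH
  simp only [p1, p2, hpr, hNs, hsj]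
  by_cases a : 0 ≤ γ j <;> by_cases b : 0 ≤ N γ - γ j
  · rw [if_pos a, if_pos b]
    have : (N γ - γ j).toNat = (N γ).toNat - (γ j).toNat := by omega
    rw [this, gb_symm q (by omega)]
  · rw [if_pos a, if_neg b]
    rw [gb, if_neg (by omega), mul_zero]
  · rw [if_neg a, if_pos b]
    rw [gb, if_neg (by omega), mul_zero]
  · rw [if_neg a, if_neg b]

noncomputable def Fold (q : K) (B : Form I) (L : List (I → ℤ)) (T : (I → ℤ) → K) : (I → ℤ) → K :=
  L.foldr (Lop q B) T

lemma Fold_cons (q : K) (B : Form I) (β) (L : List (I → ℤ)) (T : (I → ℤ) → K) :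
  Fold q B (β :: L) T = Lop q B β (Fold q B L T) := rfl

lemma Fold_NN (q : K) (B : Form I) (L : List (I → ℤ)) (hL : ∀ β ∈ L, 0 ≤ β) {T : (I → ℤ) → K}
    (hT : NN T) : NN (Fold q B L T) := by
  induction L with
  | nil => exact hT
  | cons β L ih =>
    rw [Fold_cons]
    exact Lop_NN q B (hL β (by simp)) (ih fun x hx => hL x (by simp [hx]))

lemma Fold_comm (q : K) (hq0 : q ≠ 0) (B : Form I) (L : List (I → ℤ))
    (hL : ∀ β ∈ L, 0 ≤ β ∧ β ≠ 0) {ε : I → ℤ} (g0 : 0 ≤ ε) (gne : ε ≠ 0)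
    {T : (I → ℤ) → K} (hT : NN T) :
    Fold q B L (Lop q B.flip ε T) = Lop q B.flip ε (Fold q B L T) := by
  induction L with
  | nil => rfl
  | cons β L ih =>
    rw [Fold_cons, Fold_cons, ih fun x hx => hL x (by simp [hx])]
    exact Lop_comm q hq0 B (hL β (by simp)).1 (hL β (by simp)).2 g0 gne
      (Fold_NN q B L (fun x hx => (hL x (by simp [hx])).1) hT)

lemma zero_NN : NN (fun _ => 0 : (I → ℤ) → K) := fun _ _ => rfl

lemma Lop_zero (q : K) (B : Form I) (β : I → ℤ) :
    Lop q B β (fun _ => 0) = fun _ => 0 := by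
  funext γ; simp [Lop]

lemma Fold_supp (q : K) (B : Form I) (L : List (I → ℤ))
    (hL : ∀ β ∈ L, 0 ≤ β ∧ β ≠ 0) {T : (I → ℤ) → K} (hT : NN T) (S : Set (I → ℤ))
    (hS : ∀ β ∈ L, ∀ γ ∈ S, γ + β ∈ S) (h : ∀ γ, γ ∉ S → Fold q B L T γ = 0) :
    ∀ γ, γ ∉ S → T γ = 0 := by
  induction L with
  | nil => exact h
  | cons β L ih =>
    apply ih (fun x hx => hL x (by simp [hx])) (fun x hx => hS x (by simp [hx]))
    refine Lop_inj q B (hL β (by simp)).1 (hL β (by simp)).2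
      (Fold_NN q B L (fun x hx => (hL x (by simp [hx])).1) hT) zero_NN S (hS β (by simp)) ?_
    intro γ hγ
    rw [Lop_zero]
    exact h γ hγ

lemma Lop_refl (q : K) {B : Form I} (hB : Good B) (j : I) {β : I → ℤ} (h0 : 0 ≤ β) (hne : β ≠ 0)
    (hs0 : 0 ≤ sr B j β) {T : (I → ℤ) → K} (hT : NN T) (hT' : NN (T ∘ sr B j)) :
    Lop q (rB B j) (sr B j β) T ∘ sr B j = Lop q B β (T ∘ sr B j) := by
  funext γ
  have hsne : sr B j β ≠ 0 := fun h => hne (by rw [← sr_sr hB j β, h, map_zero])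
  rw [Function.comp_apply, Lop_eq q (rB B j) hs0 hsne hT (sr B j γ) (N := ht γ + ht (sr B j γ) + 1) (by omega)]
  rw [Lop_eq q B h0 hne (T := T ∘ sr B j) hT' γ
    (N := ht γ + ht (sr B j γ) + 1) (by omega)]
  refine Finset.sum_congr rfl fun k _ => ?_
  rw [← map_smul, ← map_sub, rB_sr hB, Function.comp_apply]

lemma Fold_refl (q : K) {B : Form I} (hB : Good B) (j : I) (L : List (I → ℤ))
    (hL : ∀ β ∈ L, 0 ≤ β ∧ β ≠ 0 ∧ 0 ≤ sr B j β) {T : (I → ℤ) → K} (hT : NN T)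
    (hT' : NN (T ∘ sr B j)) :
    Fold q (rB B j) (L.map (sr B j)) T ∘ sr B j = Fold q B L (T ∘ sr B j) := by
  induction L with
  | nil => rfl
  | cons β L ih =>
    have ih := ih (fun x hx => hL x (by simp [hx]))
    have h := hL β (by simp)
    rw [List.map_cons, Fold_cons, Fold_cons, ← ih]
    apply Lop_refl q hB j h.1 h.2.1 h.2.2
    · apply Fold_NN _ _ _ _ hT
      intro x hx
      obtain ⟨y, hy, rfl⟩ := List.mem_map.1 hx
      exact (hL y (by simp [hy])).2.2
    · rw [ih]
      exact Fold_NN _ _ _ (fun x hx => (hL x (by simp [hx])).1) hT'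

/-- The cone attached to a splitting of the root list. -/
def Cn (L₁ L₂ : List (I → ℤ)) : AddSubmonoid (I → ℤ) :=
  AddSubmonoid.closure ({x | x ∈ L₂} ∪ {x | -x ∈ L₁})

theorem claim (q : K) (hq0 : q ≠ 0) (hq : ∀ k : ℕ, 1 ≤ k → q ^ k ≠ 1) (m : ℕ) :
    ∀ (B : Form I) (_ : Good B) (L₁ L₂ : List (I → ℤ)), L₁.length = m → Adm B (L₁ ++ L₂) →
      ∃ T : (I → ℤ) → K, NN T ∧ (∀ γ, T γ ≠ 0 → γ ∈ Cn L₁ L₂) ∧ Fold q B L₁ T = GG q := by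
  induction m with
  | zero =>
    intro B hB L₁ L₂ hlen h
    obtain rfl := List.length_eq_zero_iff.1 hlen
    refine ⟨GG q, GG_NN q, fun γ hγ => ?_, rfl⟩
    have hp : 0 ≤ γ := by
      by_contra hc
      exact hγ (GG_NN q γ hc)
    rw [sum_ee γ]
    refine AddSubmonoid.sum_mem _ fun i _ => ?_
    have hm : ee i ∈ Cn [] L₂ := AddSubmonoid.subset_closure
      (Or.inl (by simpa using (h.roots (ee i)).2 (ee_rt hB i)))
    have := AddSubmonoid.nsmul_mem _ hm (γ i).toNat
    rwa [← natCast_zsmul, Int.toNat_of_nonneg (hp i)] at this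
  | succ m ih =>
    intro B hB L₁ L₂ hlen h
    cases L₁ with
    | nil => simp at hlen
    | cons β L₁ =>
    rw [List.cons_append] at h
    obtain ⟨j, rfl, hj⟩ := adm_head hB h
    have hB' := rB_good hB hj
    have hA := adm_step hB h hj
    rw [List.map_append, List.append_assoc] at hA
    obtain ⟨T', hT'NN, hT'C, hT'F⟩ := ih (rB B j) hB' (L₁.map (sr B j)) (L₂.map (sr B j) ++ [ee j])
      (by simpa using hlen) hA
    -- the linear function N
    let N : (I → ℤ) →ₗ[ℤ] ℤ := LinearMap.proj j - B (ee j)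
    have hNap : ∀ x, N x = x j - B (ee j) x := fun x => rfl
    have hN0 : N (ee j) = 0 := by rw [hNap, ee_self, hB.diag]; rfl
    have hN1 : ∀ x : I → ℤ, (∀ i, i ≠ j → 0 ≤ x i) → 0 ≤ N x := by
      intro x hx
      have h1 : N x = ∑ i, x i * N (ee i) := by
        conv_lhs => rw [sum_ee x]
        simp only [map_sum, map_smul, smul_eq_mul]
      rw [h1]
      refine Finset.sum_nonneg fun i _ => ?_
      by_cases hi : i = j
      · subst hi; rw [hN0, mul_zero]
      · refine mul_nonneg (hx i hi) ?_
        rw [hNap, ee_ne (Ne.symm hi)]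
        have := hB.off j i (Ne.symm hi)
        omega
    have hN : ∀ x, 0 ≤ x → 0 ≤ N x := fun x hx => hN1 x fun i _ => hx i
    have hsj : ∀ x, sr B j x j = N x - x j := by
      intro x; rw [sr_at hB hj, hNap]; ring
    have hNs : ∀ x, N (sr B j x) = N x := by
      intro x
      rw [sr_apply, map_sub, map_smul, hN0, smul_zero, sub_zero]
    have hH1 : Lop q B (ee j) (HH q N j) = GG q :=
      Lop_HH q hq B N j (fun x => by rw [hNap]; ring) hN0 hN
    have hH2 : Lop q (rB B j).flip (ee j) (HH q N j) = GG q := by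
      refine Lop_HH q hq _ N j (fun x => ?_) hN0 hN
      rw [LinearMap.BilinForm.flip_apply, rB_apply, sr_self hB, map_neg, src_right hB hj, hsj]
      ring
    have hHs : ∀ γ, HH q N j (sr B j γ) = HH q N j γ :=
      HH_symm q N j (sr B j) (fun x i hi => sr_ne B hi x) hsj hNs hN1
    obtain ⟨T, hTNN, hTR⟩ := Lop_surj q (rB B j).flip (ee_nonneg j) (ee_ne_zero j) T' hT'NN
    have hL₁ : ∀ x ∈ L₁, IsRt B x := fun x hx => (h.roots x).1 (by simp [hx])
    have hL₁' : ∀ x ∈ L₁.map (sr B j), IsRt (rB B j) x := fun x hx =>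
      (hA.roots x).1 (List.mem_append.2 (Or.inl hx))
    have hL₁'' : ∀ x ∈ L₁.map (sr B j), 0 ≤ x ∧ x ≠ 0 := fun x hx =>
      ⟨(hL₁' x hx).1, rt_ne_zero (hL₁' x hx)⟩
    have hF : Fold q (rB B j) (L₁.map (sr B j)) T = HH q N j := by
      funext γ
      refine Lop_inj q (rB B j).flip (ee_nonneg j) (ee_ne_zero j)
        (Fold_NN q _ _ (fun x hx => (hL₁'' x hx).1) hTNN) (HH_NN q N j) ∅ (by simp) ?_ γ (by simp)
      intro δ _
      rw [← Fold_comm q hq0 _ _ hL₁'' (ee_nonneg j) (ee_ne_zero j) hTNN, hTR, hT'F, hH2]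
    -- support of T in the reflected cone
    have hTs : NN (T ∘ sr B j) := by
      have := Fold_supp q (rB B j) _ hL₁'' hTNN {γ | 0 ≤ sr B j γ} (by
        intro x hx γ hγ
        obtain ⟨y, hy, rfl⟩ := List.mem_map.1 hx
        simp only [Set.mem_ofPred_eq, map_add, sr_sr hB] at *
        exact add_nonneg hγ (hL₁ y hy).1) (by
        intro γ hγ
        rw [hF, ← hHs]
        exact HH_NN q N j _ hγ)
      intro γ hγ
      apply this
      simpa only [Set.mem_ofPred_eq, sr_sr hB] using hγ
    have hTC : ∀ γ, T γ ≠ 0 → γ ∈ Cn (L₁.map (sr B j)) (L₂.map (sr B j) ++ [ee j]) := by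
      intro γ hγ
      by_contra hc
      apply hγ
      refine Lop_inj q (rB B j).flip (ee_nonneg j) (ee_ne_zero j) hTNN zero_NN
        (Cn (L₁.map (sr B j)) (L₂.map (sr B j) ++ [ee j])) ?_ ?_ γ hc
      · intro δ hδ
        exact AddSubmonoid.add_mem _ hδ (AddSubmonoid.subset_closure (Or.inl (by simp)))
      · intro δ hδ
        rw [hTR, Lop_zero]
        by_contra hh
        exact hδ (hT'C δ hh)
    refine ⟨T ∘ sr B j, hTs, ?_, ?_⟩
    · intro γ hγ
      have h1 := hTC _ hγ
      have h2 : ∀ x, x ∈ Cn (L₁.map (sr B j)) (L₂.map (sr B j) ++ [ee j]) →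
          sr B j x ∈ Cn (ee j :: L₁) L₂ := by
        intro x hx
        unfold Cn at hx
        induction hx using AddSubmonoid.closure_induction with
        | mem x hx =>
          apply AddSubmonoid.subset_closure
          simp only [Set.mem_union, Set.mem_ofPred_eq, List.mem_append, List.mem_map,
            List.mem_cons, List.not_mem_nil, or_false] at hx ⊢
          rcases hx with (⟨y, hy, rfl⟩ | rfl) | ⟨y, hy, hxy⟩
          · left; rwa [sr_sr hB]
          · right; left; rw [sr_self hB, neg_neg]
          · right; right
            rw [← map_neg, ← hxy, sr_sr hB]; exact hy
        | zero => rw [map_zero]; exact AddSubmonoid.zero_mem _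
        | add x y _ _ hx hy => rw [map_add]; exact AddSubmonoid.add_mem _ hx hy
      have h3 := h2 _ h1
      rwa [sr_sr hB] at h3
    · rw [Fold_cons, ← Fold_refl q hB j L₁ ?_ hTNN hTs, hF]
      · have : HH q N j ∘ sr B j = HH q N j := funext hHs
        rw [this, hH1]
      · intro x hx
        refine ⟨(hL₁ x hx).1, rt_ne_zero (hL₁ x hx), ?_⟩
        exact (hL₁' _ (List.mem_map_of_mem hx)).1

/-- delta function at zero -/
def dl : (I → ℤ) → K := fun γ => if γ = 0 then 1 else 0

lemma dl_NN : NN (dl : (I → ℤ) → K) := by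
  intro γ h
  unfold dl
  rw [if_neg]
  rintro rfl
  exact h le_rfl

lemma Fold_at_zero (q : K) (B : Form I) (L : List (I → ℤ)) (T : (I → ℤ) → K) :
    Fold q B L T 0 = T 0 := by
  induction L with
  | nil => rfl
  | cons β L ih =>
    rw [Fold_cons, ← ih]
    have : ht (0 : I → ℤ) = 0 := by simp [ht]
    simp [Lop, this, PP_zero]

theorem fold_eq (q : K) (hq0 : q ≠ 0) (hq : ∀ k : ℕ, 1 ≤ k → q ^ k ≠ 1) (B : Form I) (hB : Good B)
    (L : List (I → ℤ)) (h : Adm B L) : Fold q B L dl = GG q := by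
  obtain ⟨T, hT, hC, hF⟩ := claim q hq0 hq L.length B hB L [] rfl (by simpa using h)
  have : T = dl := by
    funext γ
    unfold dl
    by_cases h0 : γ = 0
    · rw [if_pos h0, h0, ← Fold_at_zero q B L T, hF]
      simp [GG, PP_zero]
    · rw [if_neg h0]
      by_contra hne
      have hp : 0 ≤ γ := by
        by_contra hc
        exact hne (hT γ hc)
      have h1 := hC γ hne
      have h2 : ∀ x, x ∈ Cn L [] → x ≤ 0 := by
        intro x hx
        unfold Cn at hx
        induction hx using AddSubmonoid.closure_induction with
        | mem x hx =>
          rcases hx with hx | hx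
          · simp at hx
          · have := ((h.roots _).1 hx).1
            simpa using this
        | zero => exact le_rfl
        | add x y _ _ hx hy => exact add_nonpos hx hy
      exact h0 (le_antisymm (h2 γ h1) hp)
  rw [← this]; exact hF

/-- exponent -/
def ex {r : ℕ} (B : Form I) (φ : Fin r → I → ℤ) (μ : Fin r → ℕ) : ℤ :=
  ∑ u, ∑ v, if u < v then (μ u : ℤ) * μ v * B (φ u) (φ v) else 0

lemma ex_cons {r : ℕ} (B : Form I) (φ : Fin (r+1) → I → ℤ) (k : ℕ) (μ : Fin r → ℕ) :
    ex B φ (Fin.cons k μ) =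
      B ((k:ℤ) • φ 0) (∑ u, (μ u : ℤ) • φ u.succ) + ex B (fun u => φ u.succ) μ := by
  unfold ex
  rw [Fin.sum_univ_succ]
  congr 1
  · rw [Fin.sum_univ_succ]
    simp only [map_smul, map_sum, LinearMap.smul_apply, smul_eq_mul, Fin.cons_zero, Fin.cons_succ]
    rw [if_neg (lt_irrefl _), zero_add]
    refine Finset.sum_congr rfl fun v _ => ?_
    rw [if_pos (Fin.succ_pos v)]
    ring
  · refine Finset.sum_congr rfl fun u _ => ?_
    rw [Fin.sum_univ_succ]
    simp only [Fin.cons_succ, Fin.succ_lt_succ_iff]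
    rw [if_neg (by simp), zero_add]

lemma fold_sum (q : K) (hq0 : q ≠ 0) (B : Form I) {r : ℕ} (φ : Fin r → I → ℤ)
    (hφ : ∀ u, 0 ≤ φ u ∧ φ u ≠ 0) (γ : I → ℤ) (N : ℕ) (hN : ht γ < N) :
    Fold q B (List.ofFn φ) dl γ = ∑ μ ∈ Fintype.piFinset (fun _ : Fin r => Finset.range N),
      if ∑ u, (μ u : ℤ) • φ u = γ then q ^ (-(ex B φ μ)) * ∏ u, PP q (μ u) else 0 := by
  induction r generalizing γ with
  | zero =>
    simp [Fold, dl, ex, eq_comm]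
  | succ r ih =>
    rw [List.ofFn_succ, Fold_cons, Lop_eq q B (hφ 0).1 (hφ 0).2 ?_ γ hN]
    swap
    · apply Fold_NN _ _ _ _ dl_NN
      intro β hβ
      obtain ⟨u, rfl⟩ := (List.mem_ofFn' _ _).1 hβ
      exact (hφ _).1
    have e : ∀ k : ℕ, _ := fun k => ih (fun u => φ u.succ) (fun u => hφ u.succ) (γ - (k:ℤ) • φ 0)
      (lt_of_le_of_lt (ht_mono (by
        intro i
        have := (hφ 0).1 i
        simp only [Pi.sub_apply, Pi.smul_apply, smul_eq_mul, Pi.zero_apply] at *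
        nlinarith)) hN)
    simp only [e, Finset.mul_sum]
    rw [← Finset.sum_product']
    refine Finset.sum_bij' (fun p _ => Fin.cons p.1 p.2) (fun μ _ => (μ 0, Fin.tail μ)) ?_ ?_ ?_ ?_ ?_
    · rintro ⟨k, μ⟩ h
      simp only [Finset.mem_product, Fintype.mem_piFinset] at h ⊢
      intro u
      refine Fin.cases ?_ ?_ u
      · simpa using h.1
      · intro v; simpa using h.2 v
    · intro μ h
      simp only [Finset.mem_product, Fintype.mem_piFinset] at h ⊢
      exact ⟨h 0, fun u => h u.succ⟩
    · rintro ⟨k, μ⟩ _; simp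
    · intro μ _; simp
    · rintro ⟨k, μ⟩ _
      have hiff : (∑ u, ((Fin.cons k μ : Fin (r+1) → ℕ) u : ℤ) • φ u = γ) ↔
          (∑ u, (μ u : ℤ) • φ u.succ = γ - (k:ℤ) • φ 0) := by
        rw [Fin.sum_univ_succ]
        simp only [Fin.cons_zero, Fin.cons_succ]
        rw [eq_sub_iff_add_eq, add_comm]
      simp only [hiff]
      by_cases hc : ∑ u, (μ u : ℤ) • φ u.succ = γ - (k:ℤ) • φ 0
      · rw [if_pos hc, if_pos hc, ex_cons, hc, Fin.prod_univ_succ, neg_add, zpow_add₀ hq0]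
        simp only [Fin.cons_zero, Fin.cons_succ]
        ring
      · rw [if_neg hc, if_neg hc, mul_zero]

theorem thmB (q : K) (hq0 : q ≠ 0) (hq : ∀ k : ℕ, 1 ≤ k → q ^ k ≠ 1) (B : Form I) (hB : Good B)
    {r : ℕ} (φ : Fin r → I → ℤ) (hinj : Function.Injective φ)
    (hroots : ∀ β, (∃ u, φ u = β) ↔ IsRt B β)
    (hord : ∀ u v, u < v → B (φ u) (φ v) ≤ B (φ v) (φ u)) (γ : I → ℕ) :
    ∏ i, PP q (γ i) = ∑ μ ∈ (Finset.Iic fun _ : Fin r => ∑ i, γ i),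
      if ∑ u, (μ u : ℤ) • φ u = (fun i => (γ i : ℤ)) then
        q ^ (-(ex B φ μ)) * ∏ u, PP q (μ u) else 0 := by
  have hA : Adm B (List.ofFn φ) := by
    refine ⟨List.nodup_ofFn.2 hinj, fun β => ?_, ?_⟩
    · rw [← hroots, List.mem_ofFn']; rfl
    · rw [List.pairwise_ofFn]; exact fun u v h => hord u v h
  have h1 := congrFun (fold_eq q hq0 hq B hB _ hA) (fun i => (γ i : ℤ))
  have hht : ht (fun i => (γ i : ℤ)) = ∑ i, γ i := by simp [ht]
  rw [fold_sum q hq0 B φ (fun u => ?_) _ (∑ i, γ i + 1) (by omega)] at h1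
  · have h2 : GG q (fun i => (γ i : ℤ)) = ∏ i, PP q (γ i) := by
      unfold GG
      have h0 : (0 : I → ℤ) ≤ fun i => (γ i : ℤ) := fun i => Int.natCast_nonneg _
      rw [if_pos h0]
      simp
    rw [← h2, ← h1]
    refine Finset.sum_congr ?_ fun _ _ => rfl
    ext μ
    simp [Fintype.mem_piFinset, Nat.lt_succ_iff, Pi.le_def]
  · have := (hroots (φ u)).1 ⟨u, rfl⟩
    exact ⟨this.1, rt_ne_zero this⟩

end main
end KZ

open scoped BigOperators
namespace KZ
set_option linter.unusedSectionVars false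
set_option linter.unusedSimpArgs false
open Quiv

lemma sum_tri {r : ℕ} (f : Fin r → Fin r → ℤ) :
    ∑ u, ∑ v, f u v = ∑ u, f u u + ∑ u, ∑ v, if u < v then (f u v + f v u) else 0 := by
  have h : ∀ u v, f u v = (if u = v then f u v else 0) + (if u < v then f u v else 0)
      + (if v < u then f u v else 0) := by
    intro u v
    rcases lt_trichotomy u v with h | h | h
    · simp [h, h.ne, h.not_gt]
    · simp [h]
    · simp [h, h.ne', h.not_gt]
  have h2 : ∑ u, ∑ v, (if v < u then f u v else 0) = ∑ u, ∑ v, (if u < v then f v u else 0) :=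
    Finset.sum_comm
  calc ∑ u, ∑ v, f u v = ∑ u, ∑ v, ((if u = v then f u v else 0) + (if u < v then f u v else 0)
      + (if v < u then f u v else 0)) :=
        Finset.sum_congr rfl fun u _ => Finset.sum_congr rfl fun v _ => h u v
    _ = _ := by
      simp only [Finset.sum_add_distrib]
      rw [h2]
      simp only [Finset.sum_ite_eq, Finset.mem_univ, if_true, add_assoc]
      congr 1
      simp only [← Finset.sum_add_distrib]
      refine Finset.sum_congr rfl fun u _ => Finset.sum_congr rfl fun v _ => ?_
      split_ifs <;> simp

lemma quad_expand {I : Type*} {r : ℕ} (B : Form I) (ψ : Fin r → I → ℤ) (μ : Fin r → ℤ) :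
    B (∑ u, μ u • ψ u) (∑ u, μ u • ψ u) = ∑ u, μ u ^ 2 * B (ψ u) (ψ u)
      + ∑ u, ∑ v, if u < v then μ u * μ v * (B (ψ u) (ψ v) + B (ψ v) (ψ u)) else 0 := by
  have : B (∑ u, μ u • ψ u) (∑ u, μ u • ψ u) = ∑ u, ∑ v, μ u * μ v * B (ψ u) (ψ v) := by
    simp only [map_sum, map_smul, LinearMap.sum_apply, LinearMap.smul_apply, smul_eq_mul]
    rw [Finset.sum_comm]
    refine Finset.sum_congr rfl fun u _ => ?_
    rw [Finset.mul_sum]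
    exact Finset.sum_congr rfl fun v _ => by ring
  rw [this, sum_tri]
  congr 1
  · exact Finset.sum_congr rfl fun u _ => by ring
  · refine Finset.sum_congr rfl fun u _ => Finset.sum_congr rfl fun v _ => ?_
    split_ifs
    · ring
    · rfl

/-- `chiSub univ A` as a bilinear form -/
def Bf {n : ℕ} (Q : Quiv n) (A : Finset (Fin Q.m)) : Form (Fin n) :=
  LinearMap.mk₂ ℤ (Q.chiSub Finset.univ A)
    (fun x y z => by
      simp only [chiSub, Pi.add_apply, add_mul, Finset.sum_add_distrib]; ring)
    (fun c x y => by
      simp only [chiSub, Pi.smul_apply, smul_eq_mul, mul_sub, Finset.mul_sum, mul_assoc])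
    (fun x y z => by
      simp only [chiSub, Pi.add_apply, mul_add, Finset.sum_add_distrib]; ring)
    (fun c x y => by
      simp only [chiSub, Pi.smul_apply, smul_eq_mul, mul_sub, Finset.mul_sum, mul_left_comm])

lemma Bf_apply {n : ℕ} (Q : Quiv n) (A : Finset (Fin Q.m)) (x y : Fin n → ℤ) :
    Bf Q A x y = Q.chiSub Finset.univ A x y := rfl

lemma toZ_single {n : ℕ} (i : Fin n) : toZ (Pi.single i 1) = ee i := by
  funext k
  by_cases h : k = i
  · subst h; simp [Quiv.toZ, ee]
  · simp [Quiv.toZ, ee, h]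

lemma chi_ee {n : ℕ} (Q : Quiv n) (A : Finset (Fin Q.m)) (i k : Fin n) :
    Q.chiSub Finset.univ A (ee i) (ee k)
      = (if i = k then 1 else 0) - ∑ a ∈ A, if Q.ta a = i ∧ Q.ha a = k then 1 else 0 := by
  unfold chiSub
  congr 1
  · simp only [ee, Pi.single_apply]
    by_cases h : i = k
    · simp [h]
    · simp [h, Ne.symm h]
  · refine Finset.sum_congr rfl fun a _ => ?_
    simp only [ee, Pi.single_apply]
    by_cases h1 : Q.ta a = i <;> by_cases h2 : Q.ha a = k <;> simp [h1, h2]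

section
variable {n ℓ : ℕ} {Q : Quiv n}

open Classical in
/-- union of the block arrows -/
noncomputable def AU (P : DSP Q ℓ) : Finset (Fin Q.m) := Finset.univ.filter fun a => ∃ j, a ∈ P.A j

lemma mem_AU (P : DSP Q ℓ) (a : Fin Q.m) : a ∈ AU P ↔ ∃ j, a ∈ P.A j := by simp [AU]

lemma V_unique (P : DSP Q ℓ) {i : Fin n} {j j' : Fin ℓ} (h : i ∈ P.V j) (h' : i ∈ P.V j') :
    j = j' := (P.cover i).unique h h'

lemma A_ends (P : DSP Q ℓ) {a : Fin Q.m} {j : Fin ℓ} (h : a ∈ P.A j) :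
    Q.ta a ∈ P.V j ∧ Q.ha a ∈ P.V j := (P.dynkin j).2.1 a h

lemma chi_blocks (P : DSP Q ℓ) (x y : Fin n → ℤ) :
    Q.chiSub Finset.univ (AU P) x y = ∑ j, Q.chiSub (P.V j) (P.A j) x y := by
  classical
  unfold chiSub
  rw [Finset.sum_sub_distrib]
  congr 1
  · have : ∀ j, ∑ i ∈ P.V j, x i * y i = ∑ i, if i ∈ P.V j then x i * y i else 0 := by
      intro j; rw [← Finset.sum_filter]; congr 1; ext; simp
    simp only [this]
    rw [Finset.sum_comm]
    refine Finset.sum_congr rfl fun i _ => ?_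
    obtain ⟨j, hj, hu⟩ := P.cover i
    rw [Finset.sum_eq_single j]
    · rw [if_pos hj]
    · intro j' _ hne
      exact if_neg fun h => hne (hu j' h)
    · simp
  · have : ∀ j, ∑ a ∈ P.A j, x (Q.ta a) * y (Q.ha a)
        = ∑ a, if a ∈ P.A j then x (Q.ta a) * y (Q.ha a) else 0 := by
      intro j; rw [← Finset.sum_filter]; congr 1; ext; simp
    simp only [this]
    rw [Finset.sum_comm, AU, Finset.sum_filter]
    refine Finset.sum_congr rfl fun a _ => ?_
    split_ifs with h
    · obtain ⟨j, hj⟩ := h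
      rw [Finset.sum_eq_single j]
      · rw [if_pos hj]
      · intro j' _ hne
        exact if_neg fun h => hne (V_unique P (A_ends P h).1 (A_ends P hj).1)
      · simp
    · push Not at h
      exact (Finset.sum_eq_zero fun j _ => if_neg (h j)).symm

lemma chi_congr (P : DSP Q ℓ) (j : Fin ℓ) {x x' y y' : Fin n → ℤ}
    (hx : ∀ i ∈ P.V j, x i = x' i) (hy : ∀ i ∈ P.V j, y i = y' i) :
    Q.chiSub (P.V j) (P.A j) x y = Q.chiSub (P.V j) (P.A j) x' y' := by
  unfold chiSub
  congr 1
  · exact Finset.sum_congr rfl fun i hi => by rw [hx i hi, hy i hi]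
  · exact Finset.sum_congr rfl fun a ha => by
      rw [hx _ (A_ends P ha).1, hy _ (A_ends P ha).2]

lemma chi_zero_left (P : DSP Q ℓ) (j : Fin ℓ) {x y : Fin n → ℤ}
    (hx : ∀ i ∈ P.V j, x i = 0) : Q.chiSub (P.V j) (P.A j) x y = 0 := by
  rw [chi_congr P j (x' := 0) (y' := y) hx (fun _ _ => rfl)]
  simp [chiSub]

lemma chi_zero_right (P : DSP Q ℓ) (j : Fin ℓ) {x y : Fin n → ℤ}
    (hy : ∀ i ∈ P.V j, y i = 0) : Q.chiSub (P.V j) (P.A j) x y = 0 := by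
  rw [chi_congr P j (x' := x) (y' := 0) (fun _ _ => rfl) hy]
  simp [chiSub]

lemma chi_pos (P : DSP Q ℓ) (j : Fin ℓ) {x : Fin n → ℤ}
    (hx : ∃ i ∈ P.V j, x i ≠ 0) : 0 < Q.chiSub (P.V j) (P.A j) x x := by
  classical
  let x' : Fin n → ℤ := fun i => if i ∈ P.V j then x i else 0
  have h : ∀ i ∈ P.V j, x i = x' i := fun i hi => by simp [x', hi]
  rw [chi_congr P j h h]
  refine (P.dynkin j).2.2.2.2 x' (fun i hi => by simp [x', hi]) ?_
  intro h0
  obtain ⟨i, hi, hne⟩ := hx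
  exact hne (by rw [h i hi, h0]; rfl)

lemma chi_nonneg (P : DSP Q ℓ) (j : Fin ℓ) (x : Fin n → ℤ) :
    0 ≤ Q.chiSub (P.V j) (P.A j) x x := by
  by_cases h : ∃ i ∈ P.V j, x i ≠ 0
  · exact (chi_pos P j h).le
  · push Not at h
    rw [chi_zero_left P j h]

lemma Bf_good (hlt : ∀ a : Fin Q.m, Q.ha a < Q.ta a) (P : DSP Q ℓ) : Good (Bf Q (AU P)) := by
  refine ⟨fun i => ?_, fun i k hik => ?_, fun x hx => ?_⟩
  · rw [Bf_apply, chi_ee, if_pos rfl, Finset.sum_eq_zero, sub_zero]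
    intro a _
    rw [if_neg]
    rintro ⟨h1, h2⟩
    have := hlt a
    rw [h1, h2] at this
    exact lt_irrefl _ this
  · rw [Bf_apply, chi_ee, if_neg hik, zero_sub, neg_nonpos]
    exact Finset.sum_nonneg fun a _ => by split_ifs <;> simp
  · rw [Bf_apply, chi_blocks]
    obtain ⟨i, hi⟩ : ∃ i, x i ≠ 0 := by
      by_contra! h
      exact hx (funext h)
    obtain ⟨j, hj, -⟩ := P.cover i
    exact Finset.sum_pos' (fun j _ => chi_nonneg P j x)
      ⟨j, Finset.mem_univ _, chi_pos P j ⟨i, hj, hi⟩⟩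

lemma root_block (P : DSP Q ℓ) {β : Fin n → ℕ} {j : Fin ℓ} (h : β ∈ Q.PosRootsOn (P.V j) (P.A j))
    {j' : Fin ℓ} (hne : j' ≠ j) : ∀ i ∈ P.V j', toZ β i = 0 := by
  intro i hi
  have : β i = 0 := h.2.1 i (fun hc => hne (V_unique P hi hc))
  simp [Quiv.toZ, this]

lemma chi_root_left (P : DSP Q ℓ) {β : Fin n → ℕ} {j : Fin ℓ}
    (h : β ∈ Q.PosRootsOn (P.V j) (P.A j)) (y : Fin n → ℤ) :
    Q.chiSub Finset.univ (AU P) (toZ β) y = Q.chiSub (P.V j) (P.A j) (toZ β) y := by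
  rw [chi_blocks, Finset.sum_eq_single j]
  · intro j' _ hne
    exact chi_zero_left P j' (root_block P h hne)
  · simp

lemma toZ_nonneg (β : Fin n → ℕ) : 0 ≤ toZ β := fun i => Int.natCast_nonneg _

lemma roots_iff (P : DSP Q ℓ) (x : Fin n → ℤ) :
    (∃ β ∈ P.Roots, toZ β = x) ↔ IsRt (Bf Q (AU P)) x := by
  constructor
  · rintro ⟨β, hβ, rfl⟩
    obtain ⟨j, hj⟩ := Set.mem_iUnion.1 hβ
    exact ⟨toZ_nonneg β, by rw [Bf_apply, chi_root_left P hj]; exact hj.2.2⟩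
  · rintro ⟨h0, h1⟩
    have hx : toZ (fun i => (x i).toNat) = x := funext fun i => Int.toNat_of_nonneg (h0 i)
    refine ⟨fun i => (x i).toNat, ?_, hx⟩
    have hne : x ≠ 0 := by rintro rfl; simp at h1
    obtain ⟨i, hi⟩ : ∃ i, x i ≠ 0 := by
      by_contra! h
      exact hne (funext h)
    obtain ⟨j, hj, -⟩ := P.cover i
    have hpos := chi_pos P j ⟨i, hj, hi⟩
    rw [Bf_apply, chi_blocks, ← Finset.add_sum_erase _ _ (Finset.mem_univ j)] at h1
    have hrest := Finset.sum_nonneg fun j' (_ : j' ∈ Finset.univ.erase j) => chi_nonneg P j' x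
    have hz : ∑ j' ∈ Finset.univ.erase j, Q.chiSub (P.V j') (P.A j') x x = 0 := by omega
    refine Set.mem_iUnion.2 ⟨j, ?_, ?_, ?_⟩
    · intro hc
      apply hne
      rw [← hx, hc]; rfl
    · intro i' hi'
      obtain ⟨j', hj', -⟩ := P.cover i'
      have hjj : j' ≠ j := by rintro rfl; exact hi' hj'
      have := (Finset.sum_eq_zero_iff_of_nonneg (fun j' _ => chi_nonneg P j' x)).1 hz j'
        (by simp [hjj])
      by_contra hc
      have := chi_pos P j' (x := x) ⟨i', hj', fun h => hc (by simp [h])⟩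
      omega
    · rw [hx]; omega

/-- the contribution of the cut arrows -/
noncomputable def XX (P : DSP Q ℓ) (x y : Fin n → ℤ) : ℤ :=
  ∑ a ∈ (AU P)ᶜ, x (Q.ta a) * y (Q.ha a)

lemma chi_split (P : DSP Q ℓ) (x y : Fin n → ℤ) :
    Q.chi x y = Q.chiSub Finset.univ (AU P) x y - XX P x y := by
  unfold chi chiSub XX
  rw [← Finset.sum_add_sum_compl (AU P)]
  ring

lemma cut_iff (P : DSP Q ℓ) (a : Fin Q.m) : a ∈ (AU P)ᶜ ↔ P.Cut a := by
  rw [Finset.mem_compl, mem_AU]; simp [DSP.Cut]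

lemma no_loop (P : DSP Q ℓ) (hadm : P.Admissible) {a : Fin Q.m} (ha : P.Cut a) {j : Fin ℓ}
    (h1 : Q.ta a ∈ P.V j) (h2 : Q.ha a ∈ P.V j) : False :=
  hadm ⟨0, fun _ => a, fun _ => ha, fun _ => ⟨j, h2, h1⟩⟩

lemma no_two (P : DSP Q ℓ) (hadm : P.Admissible) {a b : Fin Q.m} (ha : P.Cut a) (hb : P.Cut b)
    {j j' : Fin ℓ} (h1 : Q.ta a ∈ P.V j) (h2 : Q.ha a ∈ P.V j')
    (h3 : Q.ta b ∈ P.V j') (h4 : Q.ha b ∈ P.V j) : False := by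
  refine hadm ⟨1, (![a, b] : Fin 2 → Fin Q.m), ?_, ?_⟩
  · intro i
    change P.Cut ((![a, b] : Fin 2 → Fin Q.m) (i : Fin 2))
    have : ∀ i : Fin 2, P.Cut ((![a, b] : Fin 2 → Fin Q.m) i) := by
      intro i; fin_cases i
      · exact ha
      · exact hb
    exact this i
  · have : ∀ i : Fin 2, ∃ j : Fin ℓ, Q.ha ((![a, b] : Fin 2 → Fin Q.m) i) ∈ P.V j ∧
        Q.ta ((![a, b] : Fin 2 → Fin Q.m) (i + 1)) ∈ P.V j := by
      intro i; fin_cases i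
      · exact ⟨j', h2, h3⟩
      · exact ⟨j, h4, h1⟩
    exact this

lemma mem_of_ne (P : DSP Q ℓ) {β : Fin n → ℕ} {j : Fin ℓ}
    (h : β ∈ Q.PosRootsOn (P.V j) (P.A j)) {i : Fin n} (hi : toZ β i ≠ 0) : i ∈ P.V j := by
  by_contra hc
  exact hi (by simp [Quiv.toZ, h.2.1 i hc])

lemma XX_same (P : DSP Q ℓ) (hadm : P.Admissible) {β β' : Fin n → ℕ} {j : Fin ℓ}
    (h : β ∈ Q.PosRootsOn (P.V j) (P.A j)) (h' : β' ∈ Q.PosRootsOn (P.V j) (P.A j)) :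
    XX P (toZ β) (toZ β') = 0 := by
  refine Finset.sum_eq_zero fun a ha => ?_
  by_contra hc
  have hc := mul_ne_zero_iff.1 hc
  exact no_loop P hadm ((cut_iff P a).1 ha) (mem_of_ne P h hc.1) (mem_of_ne P h' hc.2)

lemma key (P : DSP Q ℓ) (hadm : P.Admissible) {r : ℕ}
    (φ : Fin r → (Fin n → ℕ)) (hφ : P.AllowedOrder φ) {u v : Fin r} (huv : u < v) :
    XX P (toZ (φ u)) (toZ (φ v)) = 0 ∧
    Bf Q (AU P) (toZ (φ u)) (toZ (φ v)) ≤ Bf Q (AU P) (toZ (φ v)) (toZ (φ u)) := by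
  have hu : φ u ∈ P.Roots := hφ.2.1 ▸ Set.mem_range_self u
  have hv : φ v ∈ P.Roots := hφ.2.1 ▸ Set.mem_range_self v
  obtain ⟨j, hj⟩ := Set.mem_iUnion.1 hu
  obtain ⟨j', hj'⟩ := Set.mem_iUnion.1 hv
  obtain ⟨o1, o2⟩ := hφ.2.2 u v huv
  unfold lam at o1 o2
  rw [chi_split P, chi_split P (toZ (φ u))] at o1 o2
  simp only [Bf_apply]
  by_cases hjj : j = j'
  · subst hjj
    have h1 := XX_same P hadm hj hj'
    have h2 := XX_same P hadm hj' hj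
    have := o1 ⟨j, hj, hj'⟩
    exact ⟨h1, by omega⟩
  · have hn : ¬ ∃ j, φ u ∈ Q.PosRootsOn (P.V j) (P.A j) ∧ φ v ∈ Q.PosRootsOn (P.V j) (P.A j) := by
      rintro ⟨k, hk, hk'⟩
      obtain ⟨i, hi⟩ : ∃ i, φ u i ≠ 0 := by
        by_contra! h
        exact hj.1 (funext h)
      obtain ⟨i', hi'⟩ : ∃ i, φ v i ≠ 0 := by
        by_contra! h
        exact hj'.1 (funext h)
      have e1 : j = k := V_unique P (mem_of_ne P hj (i := i) (by simpa [Quiv.toZ] using hi))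
        (mem_of_ne P hk (by simpa [Quiv.toZ] using hi))
      have e2 : j' = k := V_unique P (mem_of_ne P hj' (i := i') (by simpa [Quiv.toZ] using hi'))
        (mem_of_ne P hk' (by simpa [Quiv.toZ] using hi'))
      exact hjj (e1.trans e2.symm)
    have o := o2 hn
    have c1 : Q.chiSub Finset.univ (AU P) (toZ (φ u)) (toZ (φ v)) = 0 := by
      rw [chi_root_left P hj, chi_zero_right P j (root_block P hj' hjj)]
    have c2 : Q.chiSub Finset.univ (AU P) (toZ (φ v)) (toZ (φ u)) = 0 := by
      rw [chi_root_left P hj', chi_zero_right P j' (root_block P hj (Ne.symm hjj))]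
    rw [c1, c2] at o ⊢
    refine ⟨?_, le_rfl⟩
    have xnn : 0 ≤ XX P (toZ (φ u)) (toZ (φ v)) :=
      Finset.sum_nonneg fun a _ => mul_nonneg (toZ_nonneg _ _) (toZ_nonneg _ _)
    by_contra hne
    obtain ⟨a, ha, hane⟩ := Finset.exists_ne_zero_of_sum_ne_zero hne
    have hane := mul_ne_zero_iff.1 hane
    have hy : XX P (toZ (φ v)) (toZ (φ u)) = 0 := by
      refine Finset.sum_eq_zero fun b hb => ?_
      by_contra hc
      have hc := mul_ne_zero_iff.1 hc
      exact no_two P hadm ((cut_iff P a).1 ha) ((cut_iff P b).1 hb) (mem_of_ne P hj hane.1)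
        (mem_of_ne P hj' hane.2) (mem_of_ne P hj' hc.1) (mem_of_ne P hj hc.2)
    omega

lemma exp_eq (hlt : ∀ a : Fin Q.m, Q.ha a < Q.ta a)
    (P : DSP Q ℓ) (hadm : P.Admissible) {r : ℕ}
    (φ : Fin r → (Fin n → ℕ)) (hφ : P.AllowedOrder φ) (γ : Fin n → ℕ) (μ : Fin r → ℕ)
    (hμ : ∑ u, (μ u : ℤ) • toZ (φ u) = toZ γ) :
    c2Exp Q φ μ γ = 2 * (-(ex (Bf Q (AU P)) (fun u => toZ (φ u)) μ)) := by
  have hchi : ∀ x y, Q.chi x y = Bf Q Finset.univ x y := fun _ _ => rfl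
  have h1 := quad_expand (Bf Q Finset.univ) (fun u => toZ (φ u)) (fun u => (μ u : ℤ))
  have h2 := quad_expand (Bf Q Finset.univ) (fun i : Fin n => ee i) (fun i => (γ i : ℤ))
  have hγ : ∑ i, (γ i : ℤ) • ee i = toZ γ := (sum_ee (toZ γ)).symm
  rw [hμ] at h1
  rw [hγ] at h2
  have d1 : ∀ u, Bf Q Finset.univ (toZ (φ u)) (toZ (φ u)) = 1 := by
    intro u
    have hu : φ u ∈ P.Roots := hφ.2.1 ▸ Set.mem_range_self u
    obtain ⟨j, hj⟩ := Set.mem_iUnion.1 hu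
    rw [← hchi, chi_split P, XX_same P hadm hj hj, chi_root_left P hj, hj.2.2, sub_zero]
  have d2 : ∀ i : Fin n, Bf Q Finset.univ (ee i) (ee i) = 1 := by
    intro i
    rw [Bf_apply, chi_ee, if_pos rfl, Finset.sum_eq_zero, sub_zero]
    intro a _
    rw [if_neg]
    rintro ⟨h1, h2⟩
    have := hlt a
    rw [h1, h2] at this
    exact lt_irrefl _ this
  have d3 : ∀ i k : Fin n, i < k → Bf Q Finset.univ (ee i) (ee k) = 0 := by
    intro i k hik
    rw [Bf_apply, chi_ee, if_neg hik.ne, Finset.sum_eq_zero, sub_zero]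
    intro a _
    rw [if_neg]
    rintro ⟨h1, h2⟩
    have := hlt a
    rw [h1, h2] at this
    exact lt_asymm this hik
  simp only [d1, mul_one] at h1
  simp only [d2, mul_one] at h2
  have e2 : (∑ i : Fin n, ∑ i' : Fin n, if i < i' then
      (γ i : ℤ) * (γ i' : ℤ) *
        Q.lam (Quiv.toZ (Pi.single i 1)) (Quiv.toZ (Pi.single i' 1)) else 0)
      = ∑ i : Fin n, ∑ i' : Fin n, if i < i' then (γ i : ℤ) * (γ i' : ℤ) *
        (Bf Q Finset.univ (ee i) (ee i') + Bf Q Finset.univ (ee i') (ee i)) else 0 := by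
    refine Finset.sum_congr rfl fun i _ => Finset.sum_congr rfl fun k _ => ?_
    split_ifs with h
    · rw [toZ_single, toZ_single, lam, hchi, hchi, d3 i k h]; ring
    · rfl
  have e3 : 2 * (-(ex (Bf Q (AU P)) (fun u => toZ (φ u)) μ)) =
      (∑ u : Fin r, ∑ v : Fin r, if u < v then
        (μ u : ℤ) * (μ v : ℤ) * Q.lam (Quiv.toZ (φ u)) (Quiv.toZ (φ v)) else 0)
      - (∑ u, ∑ v, if u < v then (μ u : ℤ) * μ v *
        (Bf Q Finset.univ (toZ (φ u)) (toZ (φ v)) + Bf Q Finset.univ (toZ (φ v)) (toZ (φ u))) else 0) := by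
    unfold ex
    rw [← Finset.sum_neg_distrib, Finset.mul_sum, ← Finset.sum_sub_distrib]
    refine Finset.sum_congr rfl fun u _ => ?_
    rw [← Finset.sum_neg_distrib, Finset.mul_sum, ← Finset.sum_sub_distrib]
    refine Finset.sum_congr rfl fun v _ => ?_
    split_ifs with h
    · have hx := (key P hadm φ hφ h).1
      have : Bf Q (AU P) (toZ (φ u)) (toZ (φ v)) = Bf Q Finset.univ (toZ (φ u)) (toZ (φ v)) := by
        rw [← hchi, chi_split P, hx, sub_zero]; rfl
      rw [this, lam, hchi, hchi]; ring
    · simp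
  rw [e3]
  unfold c2Exp
  rw [e2]
  linarith

end

lemma tq_pow_ne (k : ℕ) (hk : 1 ≤ k) : (tq ^ 2) ^ k ≠ 1 := by
  intro h
  have h2 : algebraMap (Polynomial ℚ) (RatFunc ℚ) (Polynomial.X ^ (2 * k)) = algebraMap _ _ 1 := by
    rw [map_pow, RatFunc.algebraMap_X, map_one, pow_mul]; exact h
  have h3 := RatFunc.algebraMap_injective ℚ h2
  have h4 := congrArg Polynomial.natDegree h3
  simp at h4
  omega

lemma Pq_eq (k : ℕ) : Pq k = PP (tq ^ 2) k := by
  unfold Pq PP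
  exact Finset.prod_congr rfl fun j _ => by rw [pow_mul]

end KZ

/-- Kazarian spectral sequence Betti-number identity: for every
dimension vector `γ`, `Π_i P_{γ(i)} = Σ_{m ⊢ γ} q^{codim η_m} Π_u P_{m_u}`,
the sum being over compatible Kostant series `m` (all of which satisfy
`m_u ≤ Σ_i γ(i)` since the roots `φ_u` are nonzero). -/
theorem statement5 {n ℓ r : ℕ} (Q : Quiv n)
    (hlt : ∀ a : Fin Q.m, Q.ha a < Q.ta a)
    (P : Quiv.DSP Q ℓ) (hadm : P.Admissible)
    (φ : Fin r → (Fin n → ℕ)) (hφ : P.AllowedOrder φ)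
    (γ : Fin n → ℕ) :
    ∏ i : Fin n, Pq (γ i) =
      ∑ μ ∈ Finset.filter (fun μ : Fin r → ℕ => (∑ u : Fin r, μ u • φ u) = γ)
          (Finset.Iic fun _ : Fin r => ∑ i : Fin n, γ i),
        tq ^ (c2Exp Q φ μ γ) * ∏ u : Fin r, Pq (μ u) := by
  classical
  have ht0 : (tq ^ 2 : RatFunc ℚ) ≠ 0 := pow_ne_zero _ RatFunc.X_ne_zero
  have hroots : ∀ β, (∃ u, Quiv.toZ (φ u) = β) ↔ KZ.IsRt (KZ.Bf Q (KZ.AU P)) β := by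
    intro β
    rw [← KZ.roots_iff, ← hφ.2.1]
    simp
  have hinj : Function.Injective (fun u => Quiv.toZ (φ u)) := by
    intro u v h
    apply hφ.1
    funext i
    have := congrFun h i
    simpa [Quiv.toZ] using this
  have main := KZ.thmB (tq ^ 2) ht0 KZ.tq_pow_ne (KZ.Bf Q (KZ.AU P)) (KZ.Bf_good hlt P)
    (fun u => Quiv.toZ (φ u)) hinj hroots (fun u v h => (KZ.key P hadm φ hφ h).2) γ
  simp only [KZ.Pq_eq]
  rw [main, Finset.sum_filter]
  refine Finset.sum_congr rfl fun μ _ => ?_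
  have hiff : (∑ u : Fin r, (μ u : ℤ) • Quiv.toZ (φ u) = fun i => (γ i : ℤ)) ↔
      (∑ u : Fin r, μ u • φ u) = γ := by
    rw [funext_iff, funext_iff]
    refine forall_congr' fun i => ?_
    simp only [Finset.sum_apply, Pi.smul_apply, smul_eq_mul, Quiv.toZ]
    norm_cast
  simp only [hiff]
  by_cases hc : (∑ u : Fin r, μ u • φ u) = γ
  · rw [if_pos hc, if_pos hc, KZ.exp_eq hlt P hadm φ hφ γ μ (hiff.2 hc), zpow_mul]
    rfl
  · rw [if_neg hc, if_neg hc]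
end

section
/- Let Q be a Dynkin quiver with set of positive roots Φ, |Φ| = N. Then there exists an enumeration β₁,…,β_N of Φ such that λ(β_u,β_v) ≥ 0 whenever u < v. -/
open scoped BigOperators

namespace DynkinOrder

variable {n : ℕ}

/-- The `i`-th coordinate vector. -/
abbrev ev (i : Fin n) : Fin n → ℤ := Pi.single i 1

/-- The reflection `s_i x = x - T(x,e_i) e_i`. -/
noncomputable def refl (T : (Fin n → ℤ) →ₗ[ℤ] (Fin n → ℤ) →ₗ[ℤ] ℤ) (i : Fin n) :
    (Fin n → ℤ) →ₗ[ℤ] (Fin n → ℤ) :=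
  LinearMap.id - (T.flip (ev i)).smulRight (ev i)

lemma refl_apply (T : (Fin n → ℤ) →ₗ[ℤ] (Fin n → ℤ) →ₗ[ℤ] ℤ) (i : Fin n) (x : Fin n → ℤ) :
    refl T i x = x - T x (ev i) • ev i := by
  simp [refl]

/-- Product of reflections along a list, the head being applied first. -/
noncomputable def cox (T : (Fin n → ℤ) →ₗ[ℤ] (Fin n → ℤ) →ₗ[ℤ] ℤ) :
    List (Fin n) → ((Fin n → ℤ) →ₗ[ℤ] (Fin n → ℤ))
  | [] => LinearMap.id
  | i :: l => (cox T l).comp (refl T i)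

/-- The standing assumptions on the symmetric form. -/
structure Sym (T : (Fin n → ℤ) →ₗ[ℤ] (Fin n → ℤ) →ₗ[ℤ] ℤ) : Prop where
  symm : ∀ x y, T x y = T y x
  diag : ∀ i, T (ev i) (ev i) = 2
  off : ∀ i j, i ≠ j → T (ev i) (ev j) ≤ 0
  pos : ∀ x, x ≠ 0 → 2 ≤ T x x

/-- The inductive state of the sink-reflection process. -/
structure St (T : (Fin n → ℤ) →ₗ[ℤ] (Fin n → ℤ) →ₗ[ℤ] ℤ)
    (B : (Fin n → ℤ) →ₗ[ℤ] (Fin n → ℤ) →ₗ[ℤ] ℤ) (L : List (Fin n))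
    (S : Set (Fin n → ℤ)) : Prop where
  sum : ∀ x y, B x y + B y x = T x y
  nodup : L.Nodup
  full : ∀ i, i ∈ L
  pw : L.Pairwise (fun a b => B (ev a) (ev b) = 0)
  root : ∀ x ∈ S, T x x = 2
  nonneg : ∀ x ∈ S, ∀ i, 0 ≤ x i
  bad : ∀ b ∈ S, ∃ c ∈ S, B b c - B c b < 0

lemma expand (x : Fin n → ℤ) : x = ∑ j, x j • ev j := by
  ext k
  simp [Finset.sum_apply, Pi.single_apply]

lemma T_refl {T : (Fin n → ℤ) →ₗ[ℤ] (Fin n → ℤ) →ₗ[ℤ] ℤ} (hT : Sym T) (i : Fin n)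
    (x y : Fin n → ℤ) : T (refl T i x) (refl T i y) = T x y := by
  simp only [refl_apply, map_sub, map_smul, LinearMap.sub_apply, LinearMap.smul_apply,
    smul_eq_mul, hT.diag]
  rw [hT.symm (ev i) y]
  ring

lemma refl_nonneg {T : (Fin n → ℤ) →ₗ[ℤ] (Fin n → ℤ) →ₗ[ℤ] ℤ} (hT : Sym T) (i : Fin n)
    (x : Fin n → ℤ) (hx : T x x = 2) (h0 : ∀ j, 0 ≤ x j) (hne : x ≠ ev i) :
    ∀ j, 0 ≤ refl T i x j := by
  intro j
  by_cases hj : j = i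
  swap
  · rw [refl_apply]
    simp [Pi.single_apply, hj, h0 j]
  subst hj
  by_contra hneg
  push Not at hneg
  set y := refl T j x with hy
  have hyy : T y y = 2 := by rw [hy, T_refl hT, hx]
  set z := y - y j • ev j with hz
  have hyz : y = z + y j • ev j := by rw [hz]; abel
  have hxz : ∀ k, k ≠ j → z k = x k := by
    intro k hk
    simp [hz, hy, refl_apply, Pi.single_apply, hk]
  have hzj : z j = 0 := by simp [hz]
  have hTz : T z (ev j) ≤ 0 := by
    rw [expand z]
    simp only [map_sum, map_smul, LinearMap.sum_apply, LinearMap.smul_apply, smul_eq_mul]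
    apply Finset.sum_nonpos
    intro k _
    by_cases hk : k = j
    · subst hk; simp [hzj]
    · rw [hxz k hk]
      exact mul_nonpos_of_nonneg_of_nonpos (h0 k) (hT.off k j hk)
  have hzne : z ≠ 0 := by
    intro hz0
    have hxj : x = x j • ev j := by
      ext k
      by_cases hk : k = j
      · subst hk; simp
      · rw [← hxz k hk, hz0]; simp [Pi.single_apply, hk]
    apply hne
    have h2 := hx
    rw [hxj] at h2
    simp only [map_smul, LinearMap.smul_apply, smul_eq_mul, hT.diag] at h2
    have h3 : x j = 1 := by have := h0 j; nlinarith
    rw [hxj, h3, one_smul]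
  have h1 := hT.pos z hzne
  have h4 : T y y = T z z + 2 * (y j * T z (ev j)) + 2 * (y j * y j) := by
    conv_lhs => rw [hyz]
    simp only [map_add, map_smul, LinearMap.add_apply, LinearMap.smul_apply, smul_eq_mul, hT.diag]
    rw [hT.symm (ev j) z]
    ring
  have h5 : 0 ≤ y j * T z (ev j) := mul_nonneg_of_nonpos_of_nonpos hneg.le hTz
  nlinarith

lemma sink_not_mem {T B : (Fin n → ℤ) →ₗ[ℤ] (Fin n → ℤ) →ₗ[ℤ] ℤ} {L : List (Fin n)}
    {S : Set (Fin n → ℤ)} {i : Fin n} (hT : Sym T) (h : St T B (i :: L) S) :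
    ev i ∉ S := by
  intro hi
  obtain ⟨c, hc, hlt⟩ := h.bad _ hi
  have hsink : ∀ j, j ≠ i → B (ev i) (ev j) = 0 := by
    intro j hj
    have := h.full j
    rw [List.mem_cons] at this
    exact (List.pairwise_cons.1 h.pw).1 j (this.resolve_left hj)
  have : B (ev i) c - B c (ev i) = ∑ j, c j * (B (ev i) (ev j) - B (ev j) (ev i)) := by
    conv_lhs => rw [expand c]
    simp only [map_sum, map_smul, LinearMap.sum_apply, LinearMap.smul_apply, smul_eq_mul]
    rw [← Finset.sum_sub_distrib]
    exact Finset.sum_congr rfl fun j _ => by ring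
  rw [this] at hlt
  refine absurd hlt (not_lt.2 (Finset.sum_nonneg fun j _ => ?_))
  by_cases hj : j = i
  · subst hj; simp
  · apply mul_nonneg (h.nonneg c hc j)
    have h1 := h.sum (ev i) (ev j)
    have h2 := hT.off i j (Ne.symm hj)
    rw [hsink j hj] at *
    linarith

lemma step {T B : (Fin n → ℤ) →ₗ[ℤ] (Fin n → ℤ) →ₗ[ℤ] ℤ} {L : List (Fin n)}
    {S : Set (Fin n → ℤ)} {i : Fin n} (hT : Sym T) (h : St T B (i :: L) S) :
    ∃ B', St T B' (L ++ [i]) (refl T i '' S) := by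
  have hinv : ∀ x, refl T i (refl T i x) = x := by
    intro x
    simp only [refl_apply, map_sub, map_smul, LinearMap.sub_apply, LinearMap.smul_apply,
      smul_eq_mul, hT.diag]
    module
  have hsink : ∀ j, j ≠ i → B (ev i) (ev j) = 0 := by
    intro j hj
    have := h.full j
    rw [List.mem_cons] at this
    exact (List.pairwise_cons.1 h.pw).1 j (this.resolve_left hj)
  have hii : B (ev i) (ev i) = 1 := by
    have h1 := h.sum (ev i) (ev i)
    rw [hT.diag] at h1
    linarith
  have hni : i ∉ L := (List.nodup_cons.1 h.nodup).1
  have hTB : ∀ j, j ≠ i → T (ev j) (ev i) = B (ev j) (ev i) := by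
    intro j hj
    rw [← h.sum, hsink j hj, add_zero]
  refine ⟨B.compl₁₂ (refl T i) (refl T i), ⟨?_, ?_, ?_, ?_, ?_, ?_, ?_⟩⟩
  · intro x y
    simp only [LinearMap.compl₁₂_apply]
    rw [h.sum, T_refl hT]
  · have := h.nodup
    rw [List.nodup_cons] at this
    exact List.Nodup.append this.2 (by simp) (by simpa using this.1)
  · intro j
    have := h.full j
    simp only [List.mem_cons, List.mem_append] at *
    tauto
  · rw [List.pairwise_append]
    refine ⟨?_, by simp, ?_⟩
    · have hp := (List.pairwise_cons.1 h.pw).2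
      refine List.Pairwise.imp_of_mem ?_ hp
      intro a b ha hb hab
      have hai : a ≠ i := fun h => hni (h ▸ ha)
      have hbi : b ≠ i := fun h => hni (h ▸ hb)
      simp only [LinearMap.compl₁₂_apply, refl_apply, map_sub, map_smul, LinearMap.sub_apply,
        LinearMap.smul_apply, smul_eq_mul, hab, hii, hsink b hbi, hTB a hai, hTB b hbi]
      ring
    · intro a ha b hb
      rw [List.mem_singleton] at hb
      subst hb
      have hai : a ≠ b := fun h => hni (h ▸ ha)
      simp only [LinearMap.compl₁₂_apply, refl_apply, map_sub, map_smul, LinearMap.sub_apply,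
        LinearMap.smul_apply, smul_eq_mul, hii, hTB a hai, hT.diag]
      ring
  · rintro _ ⟨x, hx, rfl⟩
    rw [T_refl hT, h.root x hx]
  · rintro _ ⟨x, hx, rfl⟩
    exact refl_nonneg hT i x (h.root x hx) (h.nonneg x hx)
      (fun he => sink_not_mem hT h (he ▸ hx))
  · rintro _ ⟨x, hx, rfl⟩
    obtain ⟨c, hc, hlt⟩ := h.bad x hx
    refine ⟨_, ⟨c, hc, rfl⟩, ?_⟩
    simpa [LinearMap.compl₁₂_apply, hinv] using hlt

lemma steps {T : (Fin n → ℤ) →ₗ[ℤ] (Fin n → ℤ) →ₗ[ℤ] ℤ} (hT : Sym T) (L1 : List (Fin n)) :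
    ∀ (L2 : List (Fin n)) (B : (Fin n → ℤ) →ₗ[ℤ] (Fin n → ℤ) →ₗ[ℤ] ℤ)
      (S : Set (Fin n → ℤ)), St T B (L1 ++ L2) S →
      ∃ B', St T B' (L2 ++ L1) (cox T L1 '' S) := by
  induction L1 with
  | nil =>
    intro L2 B S h
    exact ⟨B, by simpa [cox] using h⟩
  | cons i l ih =>
    intro L2 B S h
    rw [List.cons_append] at h
    obtain ⟨B1, h1⟩ := step hT h
    rw [List.append_assoc] at h1
    obtain ⟨B2, h2⟩ := ih _ _ _ h1
    refine ⟨B2, ?_⟩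
    rw [← Set.image_comp] at h2
    simpa [cox] using h2

lemma iter {T B : (Fin n → ℤ) →ₗ[ℤ] (Fin n → ℤ) →ₗ[ℤ] ℤ} (hT : Sym T) {L : List (Fin n)}
    {S : Set (Fin n → ℤ)} (h : St T B L S) (k : ℕ) :
    ∃ B', St T B' L ((cox T L)^[k] '' S) := by
  induction k with
  | zero => exact ⟨B, by simpa using h⟩
  | succ k ih =>
    obtain ⟨B1, h1⟩ := ih
    obtain ⟨B2, h2⟩ := steps hT L [] B1 _ (by simpa using h1)
    refine ⟨B2, ?_⟩
    rw [Function.iterate_succ', Set.image_comp]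
    simpa using h2

lemma cox_coord (T : (Fin n → ℤ) →ₗ[ℤ] (Fin n → ℤ) →ₗ[ℤ] ℤ) (l : List (Fin n)) (i : Fin n)
    (hi : i ∉ l) : ∀ v, cox T l v i = v i := by
  induction l with
  | nil => intro v; rfl
  | cons j l ih =>
    intro v
    rw [List.mem_cons, not_or] at hi
    simp only [cox, LinearMap.comp_apply]
    rw [ih hi.2, refl_apply]
    simp [Pi.single_apply, hi.1]

lemma cox_fixed (T : (Fin n → ℤ) →ₗ[ℤ] (Fin n → ℤ) →ₗ[ℤ] ℤ) (l : List (Fin n))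
    (hl : l.Nodup) : ∀ v, cox T l v = v → ∀ i ∈ l, T v (ev i) = 0 := by
  induction l with
  | nil => simp
  | cons j l ih =>
    intro v hv
    rw [List.nodup_cons] at hl
    simp only [cox, LinearMap.comp_apply] at hv
    have h1 := congrFun hv j
    rw [cox_coord T l j hl.1, refl_apply] at h1
    have h2 : T v (ev j) = 0 := by simpa using h1
    have h3 : refl T j v = v := by rw [refl_apply, h2]; simp
    rw [h3] at hv
    intro i hi
    rcases List.mem_cons.1 hi with rfl | hi
    · exact h2
    · exact ih hl.2 v hv i hi

lemma roots_finite {T : (Fin n → ℤ) →ₗ[ℤ] (Fin n → ℤ) →ₗ[ℤ] ℤ} (hT : Sym T) :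
    {x | T x x = 2}.Finite := by
  apply Set.Finite.of_injOn (f := fun (x : Fin n → ℤ) (i : Fin n) => (x i : ZMod 3))
    (t := Set.univ) (fun _ _ => Set.mem_univ _) _ Set.finite_univ
  intro x hx y hy hxy
  simp only [Set.mem_ofPred_eq] at hx hy
  by_contra hne
  have hd : ∀ i, ∃ z : ℤ, x i - y i = 3 * z := by
    intro i
    have h1 := congrFun hxy i
    have h2 := (ZMod.intCast_eq_intCast_iff_dvd_sub (y i) (x i) 3).1 h1.symm
    exact_mod_cast h2
  choose z hz using hd
  have hxz : x - y = (3 : ℤ) • z := by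
    ext i; simpa using hz i
  have hz0 : z ≠ 0 := by
    rintro rfl
    exact hne (sub_eq_zero.1 (by rw [hxz]; simp))
  have h1 := hT.pos z hz0
  have h2 : T (x - y) (x - y) = 9 * T z z := by
    rw [hxz]; simp only [map_smul, LinearMap.smul_apply, smul_eq_mul]; ring
  have h3 : T (x - y) (x - y) = 4 - 2 * T x y := by
    simp only [map_sub, LinearMap.sub_apply, hx, hy]
    rw [hT.symm y x]; ring
  have h4 : T (x + y) (x + y) = 4 + 2 * T x y := by
    simp only [map_add, LinearMap.add_apply, hx, hy]
    rw [hT.symm y x]; ring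
  have h5 : 0 ≤ T (x + y) (x + y) := by
    by_cases h : x + y = 0
    · rw [h]; simp
    · linarith [hT.pos _ h]
  linarith

lemma no_state {T B : (Fin n → ℤ) →ₗ[ℤ] (Fin n → ℤ) →ₗ[ℤ] ℤ} (hT : Sym T) {L : List (Fin n)}
    {S : Set (Fin n → ℤ)} (h : St T B L S) : ¬ S.Nonempty := by
  rintro ⟨g, hg⟩
  set c := cox T L with hc
  have hroot : ∀ k, T (c^[k] g) (c^[k] g) = 2 := by
    intro k
    obtain ⟨B', h'⟩ := iter hT h k
    exact h'.root _ ⟨g, hg, rfl⟩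
  have hnn : ∀ k i, 0 ≤ (c^[k] g) i := by
    intro k
    obtain ⟨B', h'⟩ := iter hT h k
    exact h'.nonneg _ ⟨g, hg, rfl⟩
  have hper : ∃ a p, 0 < p ∧ c^[a + p] g = c^[a] g := by
    haveI := (roots_finite hT).to_subtype
    obtain ⟨a, b, hab, he⟩ := Finite.exists_ne_map_eq_of_infinite
      (fun k : ℕ => (⟨c^[k] g, hroot k⟩ : {x | T x x = 2}))
    have he := congrArg Subtype.val he
    simp only at he
    rcases lt_or_gt_of_ne hab with hlt | hlt
    · exact ⟨a, b - a, by omega, by rw [he]; congr 2; omega⟩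
    · exact ⟨b, a - b, by omega, by rw [← he]; congr 2; omega⟩
  obtain ⟨a, p, hp, he⟩ := hper
  set v := ∑ k ∈ Finset.range p, c^[a + k] g with hv
  have hcv : c v = v := by
    have h1 : c v = ∑ k ∈ Finset.range p, c^[a + (k + 1)] g := by
      rw [hv, map_sum]
      refine Finset.sum_congr rfl fun k _ => ?_
      rw [← add_assoc, Function.iterate_succ_apply']
    have h2 := Finset.sum_range_succ (fun k => c^[a + k] g) p
    have h3 := Finset.sum_range_succ' (fun k => c^[a + k] g) p
    rw [h2, he] at h3
    simp only [add_zero] at h3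
    rw [h1]
    exact (add_right_cancel h3).symm
  have hT0 := cox_fixed T L h.nodup v hcv
  have hvv : T v v = 0 := by
    conv_lhs => arg 2; rw [expand v]
    simp only [map_sum, map_smul, smul_eq_mul]
    exact Finset.sum_eq_zero fun i _ => by rw [hT0 i (h.full i), mul_zero]
  have hv0 : v = 0 := by
    by_contra hne
    linarith [hT.pos v hne]
  have hz : c^[a] g = 0 := by
    ext i
    have h1 := congrFun hv0 i
    rw [hv, Finset.sum_apply] at h1
    have h2 := (Finset.sum_eq_zero_iff_of_nonneg (fun k _ => hnn (a + k) i)).1 h1 0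
      (Finset.mem_range.2 hp)
    simpa using h2
  have := hroot a
  rw [hz] at this
  simp at this

/-- The Euler form as a bilinear map. -/
noncomputable def chiB (Q : Quiv n) : (Fin n → ℤ) →ₗ[ℤ] (Fin n → ℤ) →ₗ[ℤ] ℤ :=
  LinearMap.mk₂ ℤ (fun x y => Q.chi x y)
    (fun x x' y => by
      simp only [Quiv.chi, Quiv.chiSub, Pi.add_apply, add_mul, Finset.sum_add_distrib]; ring)
    (fun c x y => by
      simp only [Quiv.chi, Quiv.chiSub, Pi.smul_apply, smul_eq_mul, mul_assoc, mul_sub,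
        Finset.mul_sum])
    (fun x y y' => by
      simp only [Quiv.chi, Quiv.chiSub, Pi.add_apply, mul_add, Finset.sum_add_distrib]; ring)
    (fun c x y => by
      simp only [Quiv.chi, Quiv.chiSub, Pi.smul_apply, smul_eq_mul, mul_left_comm _ c, mul_sub,
        Finset.mul_sum])

lemma chiB_apply (Q : Quiv n) (x y : Fin n → ℤ) : chiB Q x y = Q.chi x y := rfl

lemma chi_ev (Q : Quiv n) (i j : Fin n) : chiB Q (ev i) (ev j) =
    (if i = j then 1 else 0) -
      ∑ a, (if Q.ta a = i ∧ Q.ha a = j then 1 else 0) := by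
  rw [chiB_apply]
  simp only [Quiv.chi, Quiv.chiSub, Pi.single_apply]
  congr 1
  · simp [eq_comm]
  · refine Finset.sum_congr rfl fun a _ => ?_
    by_cases h1 : Q.ta a = i <;> by_cases h2 : Q.ha a = j <;> simp [h1, h2]

lemma exists_sink (Q : Quiv n) (hQ : Q.AcyclicOn Finset.univ) (V : Finset (Fin n))
    (hV : V.Nonempty) : ∃ i ∈ V, ∀ a, Q.ta a = i → Q.ha a ∉ V := by
  by_contra hcon
  push Not at hcon
  choose f hf hfV using hcon
  let g : V → V := fun v => ⟨Q.ha (f v.1 v.2), hfV v.1 v.2⟩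
  obtain ⟨v0, hv0⟩ := hV
  have hper : ∃ (w : V) (k : ℕ), g^[k + 1] w = w := by
    obtain ⟨a, b, hab, he⟩ := Finite.exists_ne_map_eq_of_infinite
      (fun k : ℕ => g^[k] ⟨v0, hv0⟩)
    rcases lt_or_gt_of_ne hab with hlt | hlt
    · refine ⟨g^[a] ⟨v0, hv0⟩, b - a - 1, ?_⟩
      rw [← Function.iterate_add_apply, show b - a - 1 + 1 + a = b by omega, he]
    · refine ⟨g^[b] ⟨v0, hv0⟩, a - b - 1, ?_⟩
      rw [← Function.iterate_add_apply, show a - b - 1 + 1 + b = a by omega, he]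
  obtain ⟨w, k, hw⟩ := hper
  have hp : Function.IsPeriodicPt g (k + 1) w := hw
  apply hQ
  refine ⟨k, fun j => f (g^[j.val] w).1 (g^[j.val] w).2, fun _ => Finset.mem_univ _, ?_⟩
  intro j
  rw [hf]
  have h1 : (j + 1).val = (j.val + 1) % (k + 1) := by
    rw [ZMod.val_add, ZMod.val_one_eq_one_mod]
    simp
  rw [h1, hp.iterate_mod_apply, Function.iterate_succ_apply']

lemma topo (Q : Quiv n) (hQ : Q.AcyclicOn Finset.univ) (V : Finset (Fin n)) :
    ∃ L : List (Fin n), L.Nodup ∧ (∀ i, i ∈ L ↔ i ∈ V) ∧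
      L.Pairwise (fun x y => ∀ a, ¬ (Q.ta a = x ∧ Q.ha a = y)) := by
  induction V using Finset.strongInduction with
  | H V ih =>
    rcases V.eq_empty_or_nonempty with rfl | hV
    · exact ⟨[], by simp⟩
    · obtain ⟨i, hi, hs⟩ := exists_sink Q hQ V hV
      obtain ⟨L, h1, h2, h3⟩ := ih _ (Finset.erase_ssubset hi)
      refine ⟨i :: L, ?_, ?_, ?_⟩
      · rw [List.nodup_cons]
        exact ⟨by rw [h2]; simp, h1⟩
      · intro j
        rw [List.mem_cons, h2, Finset.mem_erase]
        by_cases hj : j = i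
        · subst hj; simp [hi]
        · simp [hj]
      · rw [List.pairwise_cons]
        refine ⟨?_, h3⟩
        rintro j hj a ⟨ha, rfl⟩
        exact hs a ha (Finset.mem_of_mem_erase ((h2 _).1 hj))

lemma order_list (r : (Fin n → ℕ) → (Fin n → ℕ) → Prop) (R : Set (Fin n → ℕ))
    (hr : ∀ S : Finset (Fin n → ℕ), (S : Set _) ⊆ R → S.Nonempty → ∃ b ∈ S, ∀ c ∈ S, r c b)
    (S : Finset (Fin n → ℕ)) : (S : Set _) ⊆ R →
    ∃ l : List (Fin n → ℕ), l.Nodup ∧ (∀ x, x ∈ l ↔ x ∈ S) ∧ l.Pairwise r := by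
  induction S using Finset.strongInduction with
  | H S ih =>
    intro hS
    rcases S.eq_empty_or_nonempty with rfl | hne
    · exact ⟨[], by simp⟩
    · obtain ⟨b, hb, hbr⟩ := hr S hS hne
      obtain ⟨l, h1, h2, h3⟩ := ih _ (Finset.erase_ssubset hb)
        (fun x hx => hS (Finset.mem_of_mem_erase hx))
      refine ⟨l ++ [b], ?_, ?_, ?_⟩
      · exact List.Nodup.append h1 (by simp) (by simp [h2])
      · intro x
        rw [List.mem_append, h2, Finset.mem_erase, List.mem_singleton]
        by_cases hx : x = b
        · subst hx; simp [hb]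
        · simp [hx]
      · rw [List.pairwise_append]
        refine ⟨h3, by simp, ?_⟩
        intro x hx y hy
        rw [List.mem_singleton] at hy
        subst hy
        exact hbr x (Finset.mem_of_mem_erase ((h2 x).1 hx))

end DynkinOrder

/-- Every Dynkin quiver admits an enumeration `β₁,…,β_N` of its
(finite) set of positive roots such that `λ(β_u,β_v) ≥ 0` whenever `u < v`. -/
theorem statement7 {n : ℕ} (Q : Quiv n)
    (hdyn : Q.DynkinOn Finset.univ Finset.univ) :
    ∃ (N : ℕ) (β : Fin N → (Fin n → ℕ)), Function.Injective β ∧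
      Set.range β = Q.PosRootsOn Finset.univ Finset.univ ∧
      ∀ u v : Fin N, u < v → 0 ≤ Q.lam (Quiv.toZ (β u)) (Quiv.toZ (β v)) := by
  classical
  obtain ⟨-, -, -, hac, hpd⟩ := hdyn
  set B := DynkinOrder.chiB Q with hB
  set T := B + B.flip with hTdef
  have hTa : ∀ x y, T x y = Q.chi x y + Q.chi y x := fun x y => rfl
  have hloop : ∀ a, Q.ta a ≠ Q.ha a := by
    intro a ha
    exact hac ⟨0, fun _ => a, fun _ => Finset.mem_univ _, fun _ => ha.symm⟩
  have hT : DynkinOrder.Sym T := by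
    refine ⟨fun x y => ?_, fun i => ?_, fun i j hij => ?_, fun x hx => ?_⟩
    · rw [hTa, hTa, add_comm]
    · have h1 : B (DynkinOrder.ev i) (DynkinOrder.ev i) = 1 := by
        rw [hB, DynkinOrder.chi_ev, if_pos rfl, Finset.sum_eq_zero]
        · simp
        · intro a _
          rw [if_neg]
          rintro ⟨h1, h2⟩
          exact hloop a (h1.trans h2.symm)
      simp [hTdef, h1]
    · have h1 : ∀ i j : Fin n, i ≠ j → B (DynkinOrder.ev i) (DynkinOrder.ev j) ≤ 0 := by
        intro i j hij
        rw [hB, DynkinOrder.chi_ev, if_neg hij, zero_sub, neg_nonpos]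
        exact Finset.sum_nonneg fun a _ => by split_ifs <;> norm_num
      have h2 := h1 i j hij
      have h3 := h1 j i hij.symm
      simp only [hTdef, LinearMap.add_apply, LinearMap.flip_apply]
      linarith
    · have := hpd x (fun i hi => absurd (Finset.mem_univ i) hi) hx
      rw [hTa]
      unfold Quiv.chi
      omega
  set R := Q.PosRootsOn Finset.univ Finset.univ with hR
  have hRT : ∀ x ∈ R, T (Quiv.toZ x) (Quiv.toZ x) = 2 := by
    intro x hx
    have := hx.2.2
    rw [hTa]
    unfold Quiv.chi
    omega
  have hinj : Function.Injective (Quiv.toZ (n := n)) := by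
    intro x y hxy
    ext i
    have := congrFun hxy i
    simpa [Quiv.toZ] using this
  have hfin : R.Finite :=
    Set.Finite.of_injOn (f := Quiv.toZ) (fun x hx => hRT x hx) hinj.injOn
      (DynkinOrder.roots_finite hT)
  obtain ⟨L, hL1, hL2, hL3⟩ := DynkinOrder.topo Q hac Finset.univ
  have hLpw : L.Pairwise (fun a b => B (DynkinOrder.ev a) (DynkinOrder.ev b) = 0) := by
    refine (hL3.and hL1).imp ?_
    rintro a b ⟨hab, hne⟩
    rw [hB, DynkinOrder.chi_ev, if_neg hne, Finset.sum_eq_zero]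
    · simp
    · intro c _
      rw [if_neg (hab c)]
  have hext : ∀ S : Finset (Fin n → ℕ), (S : Set _) ⊆ R → S.Nonempty →
      ∃ b ∈ S, ∀ c ∈ S, 0 ≤ Q.lam (Quiv.toZ c) (Quiv.toZ b) := by
    intro S hS hne
    by_contra hcon
    push Not at hcon
    have hst : DynkinOrder.St T B L (Quiv.toZ '' (S : Set (Fin n → ℕ))) := by
      refine ⟨fun x y => rfl, hL1, fun i => (hL2 i).2 (Finset.mem_univ i), hLpw, ?_, ?_, ?_⟩
      · rintro _ ⟨x, hx, rfl⟩
        exact hRT x (hS hx)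
      · rintro _ ⟨x, hx, rfl⟩ i
        exact Int.natCast_nonneg _
      · rintro _ ⟨x, hx, rfl⟩
        obtain ⟨c, hc, hlt⟩ := hcon x hx
        exact ⟨_, ⟨c, hc, rfl⟩, hlt⟩
    exact DynkinOrder.no_state hT hst (by simpa using hne)
  obtain ⟨l, hl1, hl2, hl3⟩ := DynkinOrder.order_list _ R hext hfin.toFinset (by simp)
  refine ⟨l.length, l.get, List.nodup_iff_injective_get.1 hl1, ?_, ?_⟩
  · ext x
    rw [Set.range_list_get]
    simp [hl2]
  · intro u v huv
    exact List.pairwise_iff_get.1 hl3 u v huv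
end

section
/- Let Q be the equioriented A₃ quiver 1 ← 2 ← 3. Then in the completed quantum algebra Â_Q one has E(y_{α₁})·E(y_{α₂})·E(y_{α₃}) = E(y_{α₂})·E(y_{α₁+α₂})·E(y_{α₁})·E(y_{α₃}), where α_i = e_i. -/
open scoped BigOperators

/-- The equioriented `A₃` quiver `1 ← 2 ← 3` (vertices `0,1,2` of `Fin 3`
standing for `1,2,3`): arrows `2 → 1` and `3 → 2`. -/
def QA3 : Quiv 3 := ⟨2, ![1, 2], ![0, 1]⟩


open Quiv Classical in
theorem Edl_mul {n : ℕ} (Q : Quiv n) (γ : Fin n → ℕ) (i : Fin n) (hi : γ i = 1)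
    (g : AQ n) (δ : Fin n → ℕ) :
    mulQ Q (Edl γ) g δ = ∑ k ∈ Finset.range (δ i + 1),
      if k • γ ≤ δ then tq ^ (Q.lam (toZ (k • γ)) (toZ (δ - k • γ))) * (tq ^ (k ^ 2) * Pq k)
        * g (δ - k • γ) else 0 := by
  have h1 : ∀ γ₁ ∈ Finset.Iic δ, Edl γ γ₁ = ∑ k ∈ Finset.range (δ i + 1),
      if γ₁ = k • γ then tq ^ (k ^ 2) * Pq k else 0 := by
    intro γ₁ h
    rw [Finset.mem_Iic] at h
    have key : ∀ N, γ₁ i ≤ N → (∑ k ∈ Finset.range (N + 1),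
        if γ₁ = k • γ then tq ^ (k ^ 2) * Pq k else 0) =
        if γ₁ = γ₁ i • γ then tq ^ ((γ₁ i) ^ 2) * Pq (γ₁ i) else 0 := by
      intro N hN
      apply Finset.sum_eq_single_of_mem (γ₁ i) (by simp; omega)
      intro k _ hk
      rw [if_neg]
      intro h
      apply hk
      have := congrFun h i
      simp [hi] at this
      omega
    rw [key _ (h i)]
    exact key _ (Finset.single_le_sum (f := γ₁) (fun _ _ => Nat.zero_le _) (Finset.mem_univ i))
  unfold mulQ
  have h2 : ∀ γ₁ ∈ Finset.Iic δ,
      tq ^ (Q.lam (toZ γ₁) (toZ (δ - γ₁))) * Edl γ γ₁ * g (δ - γ₁) =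
      ∑ k ∈ Finset.range (δ i + 1), if γ₁ = k • γ then
        tq ^ (Q.lam (toZ γ₁) (toZ (δ - γ₁))) * (tq ^ (k ^ 2) * Pq k) * g (δ - γ₁) else 0 := by
    intro γ₁ h
    rw [h1 γ₁ h, Finset.mul_sum, Finset.sum_mul]
    refine Finset.sum_congr rfl fun k _ => ?_
    split_ifs <;> simp
  rw [Finset.sum_congr rfl h2, Finset.sum_comm]
  refine Finset.sum_congr rfl fun k _ => ?_
  rw [Finset.sum_ite_eq']
  simp only [Finset.mem_Iic]

open Quiv Classical in
theorem Edl_mul_single {n : ℕ} (Q : Quiv n) (γ : Fin n → ℕ) (i : Fin n) (hi : γ i = 1)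
    (g : AQ n) (hg : ∀ δ, δ i ≠ 0 → g δ = 0) (δ : Fin n → ℕ) :
    mulQ Q (Edl γ) g δ =
      if δ i • γ ≤ δ then tq ^ (Q.lam (toZ (δ i • γ)) (toZ (δ - δ i • γ))) *
        (tq ^ ((δ i) ^ 2) * Pq (δ i)) * g (δ - δ i • γ) else 0 := by
  rw [Edl_mul Q γ i hi]
  apply Finset.sum_eq_single_of_mem (δ i) (by simp)
  intro k hk hk'
  rw [Finset.mem_range] at hk
  rw [hg]
  · simp
  · simp [hi]; omega

theorem tq_ne : tq ≠ 0 := RatFunc.X_ne_zero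

theorem one_sub_tq_ne (j : ℕ) (hj : 0 < j) : (1 - tq ^ (2 * j) : RatFunc ℚ) ≠ 0 := by
  intro h
  have h2 : (RatFunc.X : RatFunc ℚ) ^ (2 * j) = 1 := (sub_eq_zero.1 h).symm
  rw [← RatFunc.algebraMap_X, ← map_pow, ← map_one (algebraMap (Polynomial ℚ) (RatFunc ℚ))] at h2
  have h3 := RatFunc.algebraMap_injective ℚ h2
  have h4 := congrArg Polynomial.natDegree h3
  simp at h4
  omega

theorem Pq_zero : Pq 0 = 1 := by simp [Pq]

theorem Pq_succ (k : ℕ) : (1 - tq ^ (2 * (k + 1))) * Pq (k + 1) = Pq k := by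
  unfold Pq
  rw [Finset.prod_Icc_succ_top (by omega)]
  have := one_sub_tq_ne (k + 1) (by omega)
  field_simp

/-- the terms of the Durfee rectangle identity -/
noncomputable def Gt (a b k : ℕ) : RatFunc ℚ :=
  if k ≤ a ∧ k ≤ b then tq ^ (2 * ((a - k) * (b - k))) * Pq k * Pq (a - k) * Pq (b - k) else 0

/-- first recursion piece -/
noncomputable def G1 (a b : ℕ) : ℕ → RatFunc ℚ
  | 0 => 0
  | k + 1 => match b with
    | 0 => 0
    | b + 1 => Gt a b k

theorem Gt_rec (a b k : ℕ) :
    (1 - tq ^ (2 * (a + 1))) * Gt (a + 1) b k = G1 a b k + tq ^ (2 * b) * Gt a b k := by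
  by_cases hb : k ≤ b
  swap
  · rcases k with _ | k
    · omega
    · rcases b with _ | b
      · simp [Gt, G1]
      · have : ¬ k ≤ b := by omega
        simp [Gt, G1, this]
  by_cases ha : k ≤ a + 1
  swap
  · have h1 : ¬ k ≤ a := by omega
    rcases k with _ | k
    · omega
    · rcases b with _ | b
      · omega
      · have : ¬ k ≤ a := by omega
        simp [Gt, G1, this, h1]
  obtain ⟨d, rfl⟩ := Nat.exists_eq_add_of_le hb
  obtain ⟨c, hc⟩ := Nat.exists_eq_add_of_le ha
  have e1 : G1 a (k + d) k = (1 - tq ^ (2 * k)) * Gt (a + 1) (k + d) k := by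
    rcases k with _ | k
    · simp [G1]
    · have hac : a = k + c := by omega
      subst hac
      have : k + 1 + d = (k + d) + 1 := by omega
      rw [this]
      have q1 : k + c + 1 - (k + 1) = c := by omega
      have q2 : k + d + 1 - (k + 1) = d := by omega
      have q3 : k + 1 ≤ k + c + 1 ∧ k + 1 ≤ k + d + 1 := by omega
      simp only [G1, Gt, q1, q2, q3, ← Pq_succ k]
      simp
      ring
  have e2 : tq ^ (2 * (k + d)) * Gt a (k + d) k =
      tq ^ (2 * k) * (1 - tq ^ (2 * c)) * Gt (a + 1) (k + d) k := by
    rcases c with _ | c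
    · have : ¬ k ≤ a := by omega
      simp [Gt, this]
    · have hac : a = k + c := by omega
      subst hac
      have q1 : k + c + 1 - k = c + 1 := by omega
      have q3 : k ≤ k + c + 1 := by omega
      simp only [Gt, q1, q3, Nat.add_sub_cancel_left, ← Pq_succ c]
      simp
      ring
  rw [e1, e2, hc]
  ring

theorem Gt_sum (a : ℕ) : ∀ b, ∑ k ∈ Finset.range (b + 1), Gt a b k = Pq a * Pq b := by
  induction a with
  | zero =>
    intro b
    rw [Finset.sum_eq_single_of_mem 0 (by simp)]
    · simp [Gt, Pq_zero]
    · intro k _ hk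
      simp [Gt, hk]
  | succ a ih =>
    intro b
    apply mul_left_cancel₀ (one_sub_tq_ne (a + 1) (by omega))
    rw [Finset.mul_sum, Finset.sum_congr rfl (fun k _ => Gt_rec a b k), Finset.sum_add_distrib,
      ← Finset.mul_sum, ih, ← mul_assoc (1 - _), Pq_succ, Finset.sum_range_succ']
    rcases b with _ | b
    · simp [G1, Pq_zero]
    · simp only [G1, ih, ← Pq_succ b]
      ring

open Quiv in
theorem lam_QA3 (a b c a' b' c' : ℕ) :
    QA3.lam (toZ ![a, b, c]) (toZ ![a', b', c']) =
      (b : ℤ) * a' + c * b' - b' * a - c' * b := by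
  have : QA3.m = 2 := rfl
  simp only [lam, chi, chiSub, Fin.sum_univ_three]
  have h : ∀ f : Fin QA3.m → ℤ, ∑ i, f i = f (0 : Fin 2) + f (1 : Fin 2) :=
    fun f => Fin.sum_univ_two f
  simp only [h]
  simp [QA3, Quiv.toZ]
  ring

theorem eta3 (δ : Fin 3 → ℕ) : δ = ![δ 0, δ 1, δ 2] := by
  ext i; fin_cases i <;> rfl

theorem le3 (a b c a' b' c' : ℕ) : (![a, b, c] ≤ ![a', b', c']) ↔ a ≤ a' ∧ b ≤ b' ∧ c ≤ c' := by
  simp [Pi.le_def, Fin.forall_fin_succ]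

theorem sub3 (a b c a' b' c' : ℕ) : ![a, b, c] - ![a', b', c'] = ![a - a', b - b', c - c'] := by
  simp

theorem smul3 (k a b c : ℕ) : k • ![a, b, c] = ![k * a, k * b, k * c] := by
  simp

theorem comb3 (x y z : ℤ) (p r : RatFunc ℚ) :
    tq ^ x * (tq ^ y * p) * (tq ^ z * r) = tq ^ (x + y + z) * (p * r) := by
  rw [zpow_add₀ tq_ne, zpow_add₀ tq_ne]; ring

theorem comb (x y : ℤ) (p r : RatFunc ℚ) : tq ^ x * p * (tq ^ y * r) = tq ^ (x + y) * (p * r) := by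
  rw [zpow_add₀ tq_ne]; ring

theorem h3 (a b c : ℕ) : mulQ QA3 (Edl ![0, 0, 1]) oneQ ![a, b, c] =
    if a = 0 ∧ b = 0 then tq ^ ((c : ℤ) ^ 2) * Pq c else 0 := by
  rw [Edl_mul_single QA3 _ 2 (by simp)]
  · have e : (![a, b, c] : Fin 3 → ℕ) 2 = c := rfl
    have z : (![a, b, 0] : Fin 3 → ℕ) = 0 ↔ a = 0 ∧ b = 0 := by
      simp
    rw [e, smul3, le3, sub3, lam_QA3]
    simp only [oneQ, mul_zero, mul_one, Nat.sub_zero, Nat.sub_self, z]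
    by_cases h : a = 0 ∧ b = 0
    · simp [h]
      left
      rw [← zpow_natCast]
      push_cast
      rfl
    · simp [h]
  · intro δ h
    simp only [oneQ]
    rw [if_neg]
    rintro rfl
    simp at h

theorem h23 (a b c : ℕ) :
    mulQ QA3 (Edl ![0, 1, 0]) (mulQ QA3 (Edl ![0, 0, 1]) oneQ) ![a, b, c] =
    if a = 0 then tq ^ ((b : ℤ) ^ 2 + c ^ 2 - b * c) * (Pq b * Pq c) else 0 := by
  rw [Edl_mul_single QA3 _ 1 (by simp)]
  · have e : (![a, b, c] : Fin 3 → ℕ) 1 = b := rfl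
    rw [e, smul3, le3, sub3, lam_QA3, h3]
    simp only [mul_zero, mul_one, Nat.sub_zero, Nat.sub_self]
    by_cases h : a = 0
    · simp only [h, Nat.zero_le, le_refl, and_self, if_true]
      rw [← zpow_natCast, comb3]
      congr 2
      push_cast
      ring
    · simp [h]
  · intro δ h
    rw [eta3 δ, h3]
    simp [h]

theorem h123 (a b c : ℕ) :
    mulQ QA3 (Edl ![1, 0, 0]) (mulQ QA3 (Edl ![0, 1, 0]) (mulQ QA3 (Edl ![0, 0, 1]) oneQ))
      ![a, b, c] =
    tq ^ ((a : ℤ) ^ 2 + b ^ 2 + c ^ 2 - a * b - b * c) * (Pq a * (Pq b * Pq c)) := by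
  rw [Edl_mul_single QA3 _ 0 (by simp)]
  · have e : (![a, b, c] : Fin 3 → ℕ) 0 = a := rfl
    rw [e, smul3, le3, sub3, lam_QA3, h23]
    simp only [mul_zero, mul_one, Nat.sub_zero, Nat.sub_self]
    simp only [Nat.zero_le, le_refl, and_self, if_true]
    rw [← zpow_natCast, comb3]
    congr 2
    push_cast
    ring
  · intro δ h
    rw [eta3 δ, h23]
    simp [h]

theorem h13 (a b c : ℕ) :
    mulQ QA3 (Edl ![1, 0, 0]) (mulQ QA3 (Edl ![0, 0, 1]) oneQ) ![a, b, c] =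
    if b = 0 then tq ^ ((a : ℤ) ^ 2 + c ^ 2) * (Pq a * Pq c) else 0 := by
  rw [Edl_mul_single QA3 _ 0 (by simp)]
  · have e : (![a, b, c] : Fin 3 → ℕ) 0 = a := rfl
    rw [e, smul3, le3, sub3, lam_QA3, h3]
    simp only [mul_zero, mul_one, Nat.sub_zero, Nat.sub_self]
    by_cases h : b = 0
    · simp only [h, Nat.zero_le, le_refl, and_self, if_true]
      rw [← zpow_natCast, comb3]
      congr 2
      push_cast
      ring
    · simp [h]
  · intro δ h
    rw [eta3 δ, h3]
    simp [h]

theorem h1213 (a b c : ℕ) :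
    mulQ QA3 (Edl ![1, 1, 0]) (mulQ QA3 (Edl ![1, 0, 0]) (mulQ QA3 (Edl ![0, 0, 1]) oneQ))
      ![a, b, c] =
    if b ≤ a then tq ^ ((b : ℤ) ^ 2 + (a - b) ^ 2 + c ^ 2 + b * (a - b) - b * c)
      * (Pq b * (Pq (a - b) * Pq c)) else 0 := by
  rw [Edl_mul_single QA3 _ 1 (by simp)]
  · have e : (![a, b, c] : Fin 3 → ℕ) 1 = b := rfl
    rw [e, smul3, le3, sub3, lam_QA3, h13]
    simp only [mul_zero, mul_one, Nat.sub_zero, Nat.sub_self]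
    by_cases h : b ≤ a
    · simp only [h, Nat.zero_le, le_refl, and_self, if_true]
      rw [← zpow_natCast, comb3]
      congr 2
      push_cast [h]
      ring
    · simp [h]
  · intro δ h
    rw [eta3 δ, h13]
    simp [h]

/-- In `Â_Q` for the equioriented `A₃` quiver,
`E(y_{α₁})E(y_{α₂})E(y_{α₃}) = E(y_{α₂})E(y_{α₁+α₂})E(y_{α₁})E(y_{α₃})`. -/
theorem statement9 :
    prodQ QA3 [Edl ![1, 0, 0], Edl ![0, 1, 0], Edl ![0, 0, 1]] =
      prodQ QA3 [Edl ![0, 1, 0], Edl ![1, 1, 0], Edl ![1, 0, 0], Edl ![0, 0, 1]] := by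
  simp only [prodQ, List.foldr]
  funext δ
  rw [eta3 δ]
  generalize δ 0 = a
  generalize δ 1 = b
  generalize δ 2 = c
  rw [h123, Edl_mul QA3 _ 1 (by simp)]
  have e : (![a, b, c] : Fin 3 → ℕ) 1 = b := rfl
  rw [e, ← Finset.sum_range_reflect]
  rw [← mul_assoc (Pq a), ← Gt_sum, Finset.sum_mul, Finset.mul_sum]
  refine Finset.sum_congr rfl fun k hk => ?_
  have hk' : k ≤ b := by rw [Finset.mem_range] at hk; omega
  obtain ⟨d, rfl⟩ := Nat.exists_eq_add_of_le hk'
  have q1 : k + d + 1 - 1 - k = d := by omega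
  have q2 : k + d - d = k := by omega
  rw [q1, smul3, le3, sub3, lam_QA3, h1213]
  simp only [mul_zero, mul_one, Nat.sub_zero, q2, Nat.zero_le, true_and, and_true,
    Nat.le_add_left, if_true, Gt, Nat.le_add_right, Nat.add_sub_cancel_left]
  by_cases h : k ≤ a
  · obtain ⟨m, rfl⟩ := Nat.exists_eq_add_of_le h
    simp only [Nat.le_add_right, if_true, Nat.add_sub_cancel_left]
    rw [← zpow_natCast, ← zpow_natCast, ← mul_assoc (tq ^ _) (tq ^ _) (Pq d),
      ← zpow_add₀ tq_ne, comb]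
    rw [show ∀ x y : ℤ, ∀ p1 p2 p3 p4 : RatFunc ℚ,
      tq ^ x * (tq ^ y * p1 * p2 * p3 * p4) = tq ^ (x + y) * (p3 * (p1 * (p2 * p4))) from
      fun x y p1 p2 p3 p4 => by rw [zpow_add₀ tq_ne]; ring]
    congr 2
    push_cast
    ring
  · simp [h]
end
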